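/- arXiv:1307.2937 — 2 statements merged into one kernel-verified Lean document; each statement's English description precedes it below -/
import Mathlib

section
/- Every perfectoid analytic field K is deeply ramified: for every finite extension L of K, the module of Kähler differentials Ω_{o_L/o_K} vanishes. -/
open scoped NNReal

set_option synthInstance.maxHeartbeats 1000000
set_option maxHeartbeats 1000000

/-- The valuation ring `o_K` of an analytic field `K` (a field complete with respect to a
multiplicative nonarchimedean norm, given by a rank-one valuation). -/
noncomputable abbrev OK (K : Type*) [Field K] [Valued K ℝ≥0] : Subring K :=
  Valued.v.integer

/-- `o_K/(p)`. -/
abbrev OKmodp (p : ℕ) (K : Type*) [Field K] [Valued K ℝ≥0] : Type _ :=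
  OK K ⧸ Ideal.span {(p : OK K)}

/-- `K` is discretely valued: the norm group is generated by a single `γ < 1`. -/
def IsDiscretelyValued (K : Type*) [Field K] [Valued K ℝ≥0] : Prop :=
  ∃ γ : ℝ≥0, γ < 1 ∧ ∀ x : K, x ≠ 0 → ∃ n : ℤ, Valued.v x = γ ^ n

theorem exists_galois_invariant_valuation (K : Type*) [Field K] [Valued K ℝ≥0] [CompleteSpace K]
    (hnt : ∃ x : K, Valued.v x ≠ 0 ∧ Valued.v x ≠ 1) :
    ∃ w : Valuation (AlgebraicClosure K) ℝ≥0,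
      (∀ (σ : AlgebraicClosure K ≃ₐ[K] AlgebraicClosure K) x, w (σ x) = w x) ∧
      ∀ x : K, w (algebraMap K _ x) = Valued.v x := by
  let _ : Valuation.RankOne (Valued.v : Valuation K ℝ≥0) :=
    { hom' := MonoidWithZeroHom.ValueGroup₀.embedding
      strictMono' := MonoidWithZeroHom.ValueGroup₀.embedding_strictMono
      exists_val_nontrivial := hnt }
  let _ : NontriviallyNormedField K := Valued.toNontriviallyNormedField K ℝ≥0
  have : IsUltrametricDist K := inferInstance
  let Ω := AlgebraicClosure K
  have hna : IsNonarchimedean (spectralNorm K Ω) := isNonarchimedean_spectralNorm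
  refine ⟨{ toFun := fun x => ⟨spectralNorm K Ω x, spectralNorm_nonneg x⟩
            map_zero' := ?_
            map_one' := ?_
            map_mul' := ?_
            map_add_le_max' := ?_ }, ?_, ?_⟩
  · exact NNReal.eq spectralNorm_zero
  · exact NNReal.eq spectralNorm_one
  · exact fun x y => NNReal.eq (map_mul (spectralMulAlgNorm K Ω) x y)
  · exact fun x y => hna x y
  · exact fun σ x => NNReal.eq (spectralNorm_eq_of_equiv σ x).symm
  · intro x
    refine NNReal.eq ((spectralNorm_extends (L := Ω) x).trans ?_)
    exact congrArg NNReal.toReal (Valuation.embedding_restrict _ x)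

open Polynomial

section Frobenius

theorem natCast_dvd_sum_pow_sub {R ι : Type*} [CommRing R] (p : ℕ) [Fact p.Prime]
    (s : Finset ι) (f : ι → R) : (p : R) ∣ (∑ i ∈ s, f i) ^ p - ∑ i ∈ s, f i ^ p := by
  classical
  induction s using Finset.induction_on with
  | empty => simp [(Fact.out : p.Prime).ne_zero]
  | insert a s ha ih =>
    obtain ⟨r, hr⟩ := exists_add_pow_prime_eq (Fact.out : p.Prime) (f a) (∑ i ∈ s, f i)
    rw [Finset.sum_insert ha, hr]
    convert dvd_add ih ((dvd_mul_right (p : R) (f a * ∑ i ∈ s, f i)).mul_right r) using 1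
    rw [Finset.sum_insert ha]
    ring

variable {F : Type*} [Field F] (w : Valuation F ℝ≥0) (p : ℕ) [Fact p.Prime]

theorem valuation_natCast_le_one (n : ℕ) : w (n : F) ≤ 1 := by
  induction n with
  | zero => simp
  | succ n ih => simpa using (w.map_add _ _).trans (max_le ih w.map_one.le)

theorem valuation_sum_pow_sub_le {ι : Type*} (s : Finset ι) (f : ι → F)
    (hf : ∀ i ∈ s, w (f i) ≤ 1) :
    w ((∑ i ∈ s, f i) ^ p - ∑ i ∈ s, f i ^ p) ≤ w p := by
  classical
  let g : ι → w.integer := fun i => if h : w (f i) ≤ 1 then ⟨f i, h⟩ else 0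
  obtain ⟨r, hr⟩ := natCast_dvd_sum_pow_sub p s g
  have hg : ∀ i ∈ s, (g i : F) = f i := fun i hi => by simp [g, hf i hi]
  have h := congrArg (Subtype.val : w.integer → F) hr
  push_cast at h
  rw [Finset.sum_congr rfl hg,
    Finset.sum_congr (f := fun i => (g i : F) ^ p) rfl fun i hi => by rw [hg i hi]] at h
  rw [h, map_mul]
  exact mul_le_of_le_one_right' r.2

variable {w}

theorem valuation_add_pow_sub_le {x y : F} (hx : w x ≤ 1) (hy : w y ≤ 1) :
    w ((x + y) ^ p - (x ^ p + y ^ p)) ≤ w p := by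
  have := valuation_sum_pow_sub_le w p Finset.univ ![x, y] (by simp [Fin.forall_fin_two, hx, hy])
  simpa [Fin.sum_univ_two] using this

theorem valuation_sub_pow_sub_le {x y : F} (hx : w x ≤ 1) (hy : w y ≤ 1) :
    w ((x - y) ^ p - (x ^ p - y ^ p)) ≤ w p := by
  have h := valuation_add_pow_sub_le p ((w.map_sub x y).trans (max_le hx hy)) hy
  rw [sub_add_cancel, ← w.map_neg] at h
  convert h using 2
  ring

theorem valuation_pow_sub_pow_le {x y : F} (hx : w x ≤ 1) (hy : w y ≤ 1) {c : ℝ≥0}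
    (hc : w p ≤ c) (h : w (x - y) ^ p ≤ c) : w (x ^ p - y ^ p) ≤ c := by
  have h1 := (valuation_sub_pow_sub_le p hx hy).trans hc
  rw [← map_pow] at h
  simpa using w.map_sub_le h h1

theorem valuation_sub_pow_le {x y : F} (hx : w x ≤ 1) (hy : w y ≤ 1) {c : ℝ≥0}
    (hc : w p ≤ c) (h : w (x ^ p - y ^ p) ≤ c) : w (x - y) ^ p ≤ c := by
  have h1 := (valuation_sub_pow_sub_le p hx hy).trans hc
  rw [← map_pow]
  simpa using w.map_add_le h h1

theorem valuation_pow_sub_pow_le_of_sub_le {x y : F} (hx : w x ≤ 1) (hy : w y ≤ 1) {c : ℝ≥0}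
    (h : w (x - y) ≤ c) (n : ℕ) : w (x ^ n - y ^ n) ≤ c := by
  obtain ⟨r, hr⟩ := sub_dvd_pow_sub_pow (⟨x, hx⟩ : w.integer) ⟨y, hy⟩ n
  have h' := congrArg (Subtype.val : w.integer → F) hr
  push_cast at h'
  rw [h', map_mul]
  exact (mul_le_of_le_one_right' r.2).trans h

theorem eq_of_valuation_sub_lt {x y : F} (h : w (x - y) < w y) : w x = w y := by
  simpa using w.map_add_eq_of_lt_right h

end Frobenius

section Roots

variable {F : Type*} [Field F] {w : Valuation F ℝ≥0}

theorem valuation_eval_le {G : F[X]} {c : ℝ≥0} (hG : ∀ i, w (G.coeff i) ≤ c) {y : F}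
    (hy : w y ≤ 1) : w (G.eval y) ≤ c := by
  rw [eval_eq_sum_range]
  refine w.map_sum_le fun i _ => ?_
  rw [map_mul, map_pow]
  exact (mul_le_of_le_one_right' (pow_le_one' hy i)).trans (hG i)

theorem valuation_root_le_one {G : F[X]} (hm : G.Monic) (hG : ∀ i, w (G.coeff i) ≤ 1) {y : F}
    (hy : G.eval y = 0) : w y ≤ 1 := by
  refine Valuation.Integers.mem_of_integral (Valuation.integer.integers w) (x := y) ?_
  have hl : G ∈ lifts (algebraMap w.integer F) :=
    (lifts_iff_coeff_lifts _).2 fun i => ⟨⟨G.coeff i, hG i⟩, rfl⟩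
  obtain ⟨q, hq, -, hqm⟩ := lifts_and_natDegree_eq_and_monic hl hm
  refine ⟨q, hqm, ?_⟩
  rw [← eval_map, hq, hy]

theorem valuation_multiset_prod_le_one {s : Multiset F} (h : ∀ x ∈ s, w x ≤ 1) :
    w s.prod ≤ 1 :=
  multiset_prod_mem (S := w.integer) s h

variable [IsAlgClosed F]

theorem exists_root_valuation_sub_le {G : F[X]} (hm : G.Monic) (hd : 0 < G.natDegree) (a : F) :
    ∃ y, G.eval y = 0 ∧ w (a - y) ^ G.natDegree ≤ w (G.eval a) ∧
      w (a - y) * w (G.derivative.eval y) ≤ w (G.eval a) := by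
  classical
  have hsp := IsAlgClosed.splits G
  have hne : G.roots.toFinset.Nonempty := by
    obtain ⟨y, hy⟩ := IsAlgClosed.exists_root G (by
      rw [degree_eq_natDegree hm.ne_zero]; exact_mod_cast hd.ne')
    exact ⟨y, by simpa [hm.ne_zero] using hy⟩
  obtain ⟨y, hy, hmin⟩ := Finset.exists_min_image _ (fun r => w (a - r)) hne
  simp only [Multiset.mem_toFinset] at hy hmin
  have hprod : ∀ b, G.eval b = (G.roots.map fun r => b - r).prod := fun b => by
    conv_lhs => rw [hsp.eq_prod_roots_of_monic hm]
    simp [eval_multiset_prod]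
  refine ⟨y, (mem_roots'.1 hy).2, ?_, ?_⟩
  · rw [hprod, map_multiset_prod, Multiset.map_map, hsp.natDegree_eq_card_roots]
    have := Multiset.prod_map_le_prod_map₀ (s := G.roots) (fun _ => w (a - y))
      (fun r => w (a - r)) (fun _ _ => zero_le) (fun r hr => hmin r hr)
    simpa using this
  · obtain ⟨s, hs⟩ := Multiset.exists_cons_of_mem hy
    have hG : G = (X - C y) * (s.map fun r => X - C r).prod := by
      conv_lhs => rw [hsp.eq_prod_roots_of_monic hm, hs]
      simp
    rw [hG]
    simp only [derivative_mul, eval_add, eval_mul, eval_sub, eval_X, eval_C, sub_self, zero_mul,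
      add_zero, derivative_sub, derivative_X, derivative_C, sub_zero, one_mul, map_mul,
      eval_multiset_prod, map_multiset_prod, Multiset.map_map, Function.comp_def]
    refine mul_le_mul_right ?_ _
    refine Multiset.prod_map_le_prod_map₀ _ _ (fun _ _ => zero_le) fun r hr => ?_
    have h1 := hmin r (hs ▸ Multiset.mem_cons_of_mem hr)
    have : y - r = (a - r) - (a - y) := by ring
    rw [this]
    exact w.map_sub_le le_rfl h1

theorem valuation_derivative_le_sub_of_roots {G : F[X]} (hm : G.Monic)
    (hG : ∀ i, w (G.coeff i) ≤ 1) {y z : F} (hy : G.eval y = 0) (hz : G.eval z = 0)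
    (hyz : z ≠ y) : w (G.derivative.eval y) ≤ w (y - z) := by
  have hsp := IsAlgClosed.splits G
  obtain ⟨s, hs⟩ := Multiset.exists_cons_of_mem ((mem_roots hm.ne_zero).2 hy)
  have hzs : z ∈ s := by
    have : z ∈ G.roots := (mem_roots hm.ne_zero).2 hz
    rw [hs, Multiset.mem_cons] at this
    exact this.resolve_left hyz
  obtain ⟨u, hu⟩ := Multiset.exists_cons_of_mem hzs
  have hGe : G = (X - C y) * ((X - C z) * (u.map fun r => X - C r).prod) := by
    conv_lhs => rw [hsp.eq_prod_roots_of_monic hm, hs, hu]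
    simp
  have hr : ∀ r ∈ u, w r ≤ 1 := fun r hr => valuation_root_le_one hm hG
    ((mem_roots hm.ne_zero).1 (by rw [hs, hu]; simp [hr]))
  rw [hGe]
  simp only [derivative_mul, eval_add, eval_mul, eval_sub, eval_X, eval_C, sub_self, zero_mul,
      add_zero, derivative_sub, derivative_X, derivative_C, sub_zero, one_mul, map_mul,
      eval_multiset_prod, Multiset.map_map, Function.comp_def]
  refine mul_le_of_le_one_right' (valuation_multiset_prod_le_one ?_)
  intro x hx
  obtain ⟨r, hru, rfl⟩ := Multiset.mem_map.1 hx
  exact w.map_sub_le (valuation_root_le_one hm hG hy) (hr r hru)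

end Roots

theorem exists_seq_of_forall_exists {α : Type*} {P : ℕ → α → Prop} {R : ℕ → α → α → Prop}
    (h : ∀ n a, P n a → ∃ b, P (n + 1) b ∧ R n a b) {a : α} (ha : P 0 a) :
    ∃ s : ℕ → α, s 0 = a ∧ ∀ n, P n (s n) ∧ R n (s n) (s (n + 1)) := by
  choose! g hg using h
  have hP : ∀ n, P n (Nat.rec (motive := fun _ => α) a g n) := fun n => by
    induction n with
    | zero => exact ha
    | succ n ih => exact (hg n _ ih).1
  exact ⟨fun n => Nat.rec a g n, rfl, fun n => ⟨hP n, (hg n _ (hP n)).2⟩⟩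

section CoeffMap

variable {F : Type*} [Field F]

/-- Apply a function to the coefficients of a polynomial. -/
noncomputable def coeffMap (r : F → F) (G : F[X]) : F[X] :=
  ∑ i ∈ Finset.range (G.natDegree + 1), monomial i (r (G.coeff i))

variable {r : F → F} (h0 : r 0 = 0) (G : F[X])
include h0

theorem coeff_coeffMap (i : ℕ) : (coeffMap r G).coeff i = r (G.coeff i) := by
  simp only [coeffMap, finsetSum_coeff, coeff_monomial, Finset.sum_ite_eq', Finset.mem_range,
    Nat.lt_succ_iff]
  split_ifs with h
  · rfl
  · rw [coeff_eq_zero_of_natDegree_lt (not_le.1 h), h0]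

theorem natDegree_coeffMap_of_monic (h1 : r 1 = 1) {G : F[X]} (hG : G.Monic) :
    (coeffMap r G).natDegree = G.natDegree := by
  refine natDegree_eq_of_le_of_coeff_ne_zero (natDegree_le_iff_coeff_eq_zero.2 fun N hN => ?_) ?_
  · rw [coeff_coeffMap h0, coeff_eq_zero_of_natDegree_lt hN, h0]
  · rw [coeff_coeffMap h0, hG.coeff_natDegree, h1]
    exact one_ne_zero

theorem monic_coeffMap (h1 : r 1 = 1) {G : F[X]} (hG : G.Monic) : (coeffMap r G).Monic := by
  rw [Monic, leadingCoeff, natDegree_coeffMap_of_monic h0 h1 hG, coeff_coeffMap h0,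
    hG.coeff_natDegree, h1]

end CoeffMap

section Seeds

variable {K M : Type*} [Field K] [Field M] [Algebra K M] (w : Valuation M ℝ≥0) (p : ℕ)

/-- Every integral element of `E` is congruent modulo `p` to a `p`-th power in `E`. -/
def FrobeniusSurjective (E : IntermediateField K M) : Prop :=
  ∀ x ∈ E, w x ≤ 1 → ∃ y ∈ E, w (x - y ^ p) ≤ w p

/-- An integral monic polynomial over `E` whose derivative is congruent modulo `p` to a constant
of valuation `τ`. -/
structure IsAlmostSeparable (E : IntermediateField K M) (τ : ℝ≥0) (G : M[X]) : Prop where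
  monic : G.Monic
  coeff_mem : ∀ i, G.coeff i ∈ E
  coeff_le_one : ∀ i, w (G.coeff i) ≤ 1
  valuation_coeff_one : w (G.coeff 1) = τ
  coeff_eq_zero : ∀ i, i ≠ 1 → ¬ p ∣ i → G.coeff i = 0

variable {w p} [Fact p.Prime] {E : IntermediateField K M}

theorem exists_coeff_root (hE : FrobeniusSurjective w p E) :
    ∃ r : M → M, r 0 = 0 ∧ r 1 = 1 ∧
      ∀ x ∈ E, w x ≤ 1 → r x ∈ E ∧ w (r x) ≤ 1 ∧ w (r x ^ p - x) ≤ w p := by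
  classical
  have hp0 : p ≠ 0 := (Fact.out : p.Prime).ne_zero
  have h : ∀ x, ∃ y, (x = 0 → y = 0) ∧ (x = 1 → y = 1) ∧
      (x ∈ E → w x ≤ 1 → y ∈ E ∧ w y ≤ 1 ∧ w (y ^ p - x) ≤ w p) := by
    intro x
    by_cases hx0 : x = 0
    · exact ⟨0, by simp [hx0, hp0]⟩
    by_cases hx1 : x = 1
    · exact ⟨1, by simp [hx1]⟩
    by_cases hx : x ∈ E ∧ w x ≤ 1
    · obtain ⟨y, hy, hxy⟩ := hE x hx.1 hx.2
      refine ⟨y, by simp [hx0], by simp [hx1], fun _ _ => ⟨hy, ?_, ?_⟩⟩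
      · rw [← pow_le_one_iff hp0, ← map_pow]
        have := w.map_sub_le hx.2 (hxy.trans (valuation_natCast_le_one w p))
        simpa using this
      · rwa [← neg_sub, w.map_neg]
    · exact ⟨0, by simp [hx0], by simp [hx1], fun h1 h2 => absurd ⟨h1, h2⟩ hx⟩
  choose r h0 h1 hr using h
  exact ⟨r, h0 0 rfl, h1 1 rfl, hr⟩

omit [Fact p.Prime] in
theorem IsAlmostSeparable.valuation_derivative {τ : ℝ≥0} {G : M[X]}
    (hG : IsAlmostSeparable w p E τ G) (hτ : w p < τ) {y : M} (hy : w y ≤ 1) :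
    w (G.derivative.eval y) = τ := by
  have h : w ((G.derivative - C (G.coeff 1)).eval y) ≤ w p := by
    refine valuation_eval_le (fun i => ?_) hy
    rw [coeff_sub, coeff_derivative, coeff_C]
    rcases Nat.eq_zero_or_pos i with rfl | hi
    · simp
    · rw [if_neg hi.ne', sub_zero]
      by_cases hpi : p ∣ i + 1
      · obtain ⟨k, hk⟩ := hpi
        have : ((i : M) + 1) = (p : M) * k := by exact_mod_cast congrArg (Nat.cast : ℕ → M) hk
        rw [this, map_mul, map_mul]
        calc _ ≤ 1 * (w p * 1) := by
              gcongr
              · exact hG.coeff_le_one _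
              · exact valuation_natCast_le_one w k
          _ = w p := by simp
      · rw [hG.coeff_eq_zero _ (by lia) hpi]
        simp
  rw [eval_sub, eval_C] at h
  rw [← hG.valuation_coeff_one]
  exact eq_of_valuation_sub_lt (h.trans_lt (hG.valuation_coeff_one ▸ hτ))

theorem valuation_eval_pow_sub_le {G : M[X]} (hG : ∀ i, w (G.coeff i) ≤ 1) {y : M}
    (hy : w y ≤ 1) :
    w (G.eval y ^ p - ∑ i ∈ Finset.range (G.natDegree + 1), G.coeff i ^ p * (y ^ p) ^ i)
      ≤ w p := by
  rw [eval_eq_sum_range]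
  have := valuation_sum_pow_sub_le w p (Finset.range (G.natDegree + 1))
    (fun i => G.coeff i * y ^ i) fun i _ => by
      rw [map_mul, map_pow]
      exact mul_le_one' (hG i) (pow_le_one' hy i)
  convert this using 5 with i hi
  rw [mul_pow, ← pow_mul, ← pow_mul, mul_comm p]

theorem IsAlmostSeparable.exists_frobenius_root (hE : FrobeniusSurjective w p E) {τ τ' : ℝ≥0}
    {G : M[X]} (hG : IsAlmostSeparable w p E τ G) (hτ : w p < τ) (hτ' : τ' ^ p = τ) :
    ∃ G', IsAlmostSeparable w p E τ' G' ∧ G'.natDegree = G.natDegree ∧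
      ∀ y, w y ≤ 1 → w (G'.eval y ^ p - G.eval (y ^ p)) ≤ w p := by
  obtain ⟨r, h0, h1, hr⟩ := exists_coeff_root hE
  have hr' := fun i => hr _ (hG.coeff_mem i) (hG.coeff_le_one i)
  have hle : ∀ i, w ((coeffMap r G).coeff i) ≤ 1 := fun i => by
    rw [coeff_coeffMap h0]; exact (hr' i).2.1
  refine ⟨coeffMap r G, ⟨monic_coeffMap h0 h1 hG.monic, fun i => ?_, hle, ?_, ?_⟩,
    natDegree_coeffMap_of_monic h0 h1 hG.monic, fun y hy => ?_⟩
  · rw [coeff_coeffMap h0]; exact (hr' i).1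
  · rw [coeff_coeffMap h0]
    have h := eq_of_valuation_sub_lt
      ((hr' 1).2.2.trans_lt (hτ.trans_eq hG.valuation_coeff_one.symm))
    rw [hG.valuation_coeff_one, ← hτ', map_pow] at h
    exact (pow_left_inj₀ zero_le zero_le (Fact.out : p.Prime).ne_zero).1 h
  · intro i hi hpi
    rw [coeff_coeffMap h0, hG.coeff_eq_zero i hi hpi, h0]
  · have h2 := valuation_eval_pow_sub_le (p := p) hle hy
    rw [natDegree_coeffMap_of_monic h0 h1 hG.monic] at h2
    have h3 : w (∑ i ∈ Finset.range (G.natDegree + 1), (coeffMap r G).coeff i ^ p * (y ^ p) ^ i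
        - G.eval (y ^ p)) ≤ w p := by
      rw [eval_eq_sum_range, ← Finset.sum_sub_distrib]
      refine w.map_sum_le fun i _ => ?_
      rw [← sub_mul, map_mul, coeff_coeffMap h0, map_pow, map_pow]
      exact (mul_le_of_le_one_right' (pow_le_one' (pow_le_one' hy _) _)).trans (hr' i).2.2
    simpa using w.map_add_le h2 h3

theorem exists_isAlmostSeparable {f : M[X]} (hm : f.Monic) (hd : 0 < f.natDegree)
    (hmem : ∀ i, f.coeff i ∈ E) (hle : ∀ i, w (f.coeff i) ≤ 1) {t : M} (ht : t ∈ E)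
    (ht1 : w t ≤ 1) :
    ∃ G, IsAlmostSeparable w p E (w t) G ∧ G.natDegree = p * f.natDegree ∧
      ∀ y, w y ≤ 1 → w (G.eval y - (f.eval y ^ p + t * y)) ≤ w p := by
  have hp : p.Prime := Fact.out
  let r : M → M := fun x => x ^ p
  have h0 : r 0 = 0 := zero_pow hp.ne_zero
  have h1 : r 1 = 1 := one_pow p
  let g := expand M p (coeffMap r f)
  have hgm : g.Monic := (monic_coeffMap h0 h1 hm).expand hp.pos
  have hgd : g.natDegree = p * f.natDegree := by
    rw [natDegree_expand, natDegree_coeffMap_of_monic h0 h1 hm, mul_comm]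
  have hgc : ∀ i, g.coeff i = if p ∣ i then f.coeff (i / p) ^ p else 0 := fun i => by
    rw [coeff_expand hp.pos]; simp only [coeff_coeffMap h0, r]
  have hlt : (C t * X).natDegree < g.natDegree :=
    ((natDegree_C_mul_le t X).trans natDegree_X_le).trans_lt (by
      rw [hgd]; exact hp.one_lt.trans_le (Nat.le_mul_of_pos_right _ hd))
  have hdlt : (C t * X).degree < g.degree := degree_lt_degree hlt
  have h1p : ¬ p ∣ 1 := hp.one_lt.ne' ∘ Nat.dvd_one.1
  have hc : ∀ i, (g + C t * X).coeff i = g.coeff i + if i = 1 then t else 0 := fun i => by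
    rw [coeff_add, coeff_C_mul_X]
  refine ⟨g + C t * X, ⟨hgm.add_of_left hdlt, fun i => ?_, fun i => ?_, ?_, ?_⟩, ?_, ?_⟩
  · rw [hc, hgc]
    refine add_mem ?_ ?_ <;> split_ifs
    exacts [pow_mem (hmem _) _, zero_mem _, ht, zero_mem _]
  · rw [hc, hgc]
    refine w.map_add_le ?_ ?_ <;> split_ifs
    · rw [map_pow]; exact pow_le_one' (hle _) _
    · simp
    · exact ht1
    · simp
  · rw [hc, hgc, if_neg h1p]; simp
  · intro i hi hpi
    rw [hc, hgc, if_neg hpi, if_neg hi, add_zero]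
  · rw [natDegree_add_eq_left_of_natDegree_lt hlt, hgd]
  · intro y hy
    have h := valuation_eval_pow_sub_le (p := p) hle hy
    have hge : g.eval y = ∑ i ∈ Finset.range (f.natDegree + 1), f.coeff i ^ p * (y ^ p) ^ i := by
      rw [expand_eval, eval_eq_sum_range, natDegree_coeffMap_of_monic h0 h1 hm]
      simp only [coeff_coeffMap h0, r]
    rw [← hge, ← w.map_neg] at h
    convert h using 2
    simp

end Seeds

section Conjugates

variable {k M : Type*} [Field k] [CharZero k] [Field M] [Algebra k M] [IsAlgClosed M]
  [Algebra.IsAlgebraic k M]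

omit [CharZero k] in
theorem normal_of_isAlgebraic_isAlgClosed : Normal k M :=
  have : IsAlgClosure k M := ⟨inferInstance, inferInstance⟩
  IsAlgClosure.normal k M

variable {w : Valuation M ℝ≥0} (hinv : ∀ (σ : M ≃ₐ[k] M) x, w (σ x) = w x)
include hinv

omit [CharZero k] in
theorem valuation_eq_of_aeval_minpoly_eq_zero {x y : M} (h : aeval y (minpoly k x) = 0) :
    w y = w x := by
  have := normal_of_isAlgebraic_isAlgClosed (k := k) (M := M)
  obtain ⟨σ, hσ⟩ := minpoly.exists_algEquiv_of_root (Algebra.IsAlgebraic.isAlgebraic x) h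
  rw [← hσ, hinv]

omit [CharZero k] in
theorem valuation_coeff_minpoly_le_one {x : M} (hx : w x ≤ 1) (i : ℕ) :
    w (algebraMap k M ((minpoly k x).coeff i)) ≤ 1 := by
  have hm : ((minpoly k x).map (algebraMap k M)).Monic :=
    (minpoly.monic (Algebra.IsIntegral.isIntegral x)).map _
  have hl : (minpoly k x).map (algebraMap k M) ∈ lifts (algebraMap w.integer M) := by
    rw [(IsAlgClosed.splits _).eq_prod_roots_of_monic hm]
    refine multiset_prod_mem _ fun q hq => ?_
    obtain ⟨r, hr, rfl⟩ := Multiset.mem_map.1 hq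
    have hr1 : w r ≤ 1 := by
      rw [valuation_eq_of_aeval_minpoly_eq_zero hinv (x := x) (y := r)
        (by simpa [eval_map_algebraMap] using ((mem_roots hm.ne_zero).1 hr))]
      exact hx
    exact (lifts_iff_set_range _).2 ⟨X - C ⟨r, hr1⟩, by simp; rfl⟩
  obtain ⟨c, hc⟩ := (lifts_iff_coeff_lifts _).1 hl i
  rw [← coeff_map, ← hc]
  exact c.2

omit [CharZero k] in
theorem valuation_algHom_eq {F : Type*} [Field F] [Algebra k F] (σ φ : F →ₐ[k] M) (x : F) :
    w (σ x) = w (φ x) := by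
  refine valuation_eq_of_aeval_minpoly_eq_zero hinv ?_
  rw [minpoly.algHom_eq φ φ.injective, aeval_algHom_apply, minpoly.aeval, map_zero]

theorem valuation_trace_le {F : Type*} [Field F] [Algebra k F] [FiniteDimensional k F]
    (φ : F →ₐ[k] M) {x : F} {c : ℝ≥0} (hx : w (φ x) ≤ c) :
    w (algebraMap k M (Algebra.trace k F x)) ≤ c := by
  rw [trace_eq_sum_embeddings M]
  refine w.map_sum_le fun σ _ => ?_
  rw [valuation_algHom_eq hinv σ φ]
  exact hx

omit [CharZero k] hinv in
theorem valuation_aeval_derivative_le {G : k[X]} (hm : G.Monic)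
    (hG : ∀ i, w (algebraMap k M (G.coeff i)) ≤ 1) {y : M} (hy : aeval y G = 0) :
    w (aeval y (derivative G)) ≤ w (aeval y (derivative (minpoly k y))) := by
  obtain ⟨H, hH⟩ := minpoly.dvd k y hy
  have hint : ∀ r, aeval r G = 0 → w r ≤ 1 := fun r hr =>
    valuation_root_le_one (hm.map (algebraMap k M)) (by simpa using hG)
      (by rwa [eval_map_algebraMap])
  have hHm : H.Monic := (minpoly.monic (Algebra.IsIntegral.isIntegral y)).of_mul_monic_left
    (hH ▸ hm)
  have hHm' := hHm.map (algebraMap k M)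
  have hHy : w (aeval y H) ≤ 1 := by
    rw [← eval_map_algebraMap, (IsAlgClosed.splits _).eq_prod_roots_of_monic hHm',
      eval_multiset_prod, Multiset.map_map]
    refine valuation_multiset_prod_le_one fun x hx => ?_
    obtain ⟨r, hr, rfl⟩ := Multiset.mem_map.1 hx
    have hr0 : aeval r H = 0 := by
      simpa [eval_map_algebraMap] using ((mem_roots hHm'.ne_zero).1 hr)
    have := w.map_sub_le (hint y hy) (hint r (by rw [hH, map_mul, hr0, mul_zero]))
    simpa using this
  rw [hH, derivative_mul, map_add, map_mul, map_mul, minpoly.aeval, zero_mul, add_zero, map_mul]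
  exact mul_le_of_le_one_right' hHy

variable {F : Type*} [Field F] [Algebra k F] (φ : F →ₐ[k] M) (pb : PowerBasis k F)
  (hpb : w (φ pb.gen) ≤ 1)
include hpb

theorem exists_dual_of_powerBasis :
    ∃ e : Fin pb.dim → F,
      (∀ i, w (φ (e i)) * w (φ (aeval pb.gen (derivative (minpoly k pb.gen)))) ≤ 1) ∧
      ∀ x, x = ∑ i, algebraMap k F (Algebra.trace k F (e i * x)) * pb.gen ^ (i : ℕ) := by
  have := pb.finite
  refine ⟨pb.basis.traceDual, fun i => ?_, fun x => ?_⟩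
  · have hc : ∀ j, w (φ ((minpolyDiv k pb.gen).coeff j)) ≤ 1 := by
      intro j
      by_contra H
      have : ∀ i, ¬ w (φ ((minpolyDiv k pb.gen).coeff (j + i))) ≤ 1 := by
        intro i
        induction i with
        | zero => exact H
        | succ i IH =>
          intro h
          refine IH ?_
          rw [coeff_minpolyDiv, map_add, φ.commutes, map_mul]
          refine w.map_add_le ?_ ?_
          · have := valuation_coeff_minpoly_le_one hinv hpb (j + i + 1)
            rwa [minpoly.algHom_eq φ φ.injective] at this
          · rw [map_mul]
            exact mul_le_one' h hpb
      refine this ((minpolyDiv k pb.gen).natDegree + 1) ?_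
      rw [coeff_eq_zero_of_natDegree_lt (by lia)]
      simp
    rw [Module.Basis.traceDual_powerBasis_eq, map_div₀, map_div₀]
    refine le_trans ?_ (hc i)
    rcases eq_or_ne (w (φ (aeval pb.gen (derivative (minpoly k pb.gen))))) 0 with h0 | h0
    · simp [h0]
    · rw [div_mul_cancel₀ _ h0]
  · conv_lhs => rw [← pb.basis.sum_repr x]
    refine Finset.sum_congr rfl fun i _ => ?_
    rw [pb.basis_eq_pow, Algebra.smul_def, mul_comm (pb.basis.traceDual i) x]
    congr 2
    conv_rhs => rw [← pb.basis.sum_repr x]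
    have key : ∀ j : Fin pb.dim, Algebra.trace k F (pb.gen ^ (j : ℕ) * pb.basis.traceDual i) =
        if j = i then 1 else 0 := fun j => by
      rw [← pb.basis_eq_pow, mul_comm, Module.Basis.trace_traceDual_mul]
    simp [Finset.sum_mul, key]

variable {t : k}
  (ht : w (algebraMap k M t) ≤ w (φ (aeval pb.gen (derivative (minpoly k pb.gen)))))
include ht

theorem exists_smul_eq_sum_pow {x : F} (hx : w (φ x) ≤ 1) :
    ∃ h : Fin pb.dim → k, (∀ i, w (algebraMap k M (h i)) ≤ 1) ∧
      algebraMap k F t * x = ∑ i, algebraMap k F (h i) * pb.gen ^ (i : ℕ) := by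
  have := pb.finite
  obtain ⟨e, he, hex⟩ := exists_dual_of_powerBasis hinv φ pb hpb
  refine ⟨fun i => Algebra.trace k F (e i * (algebraMap k F t * x)), fun i => ?_, hex _⟩
  refine valuation_trace_le hinv φ ?_
  rw [map_mul, map_mul, map_mul, map_mul, φ.commutes, ← mul_assoc]
  exact mul_le_one' ((mul_le_mul_right ht _).trans (he i)) hx

theorem exists_valuation_le_trace :
    ∃ z : F, w (φ z) ≤ 1 ∧
      w (algebraMap k M t) ≤ w (algebraMap k M (Algebra.trace k F z)) := by
  have := pb.finite
  obtain ⟨e, he, hex⟩ := exists_dual_of_powerBasis hinv φ pb hpb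
  obtain ⟨i, hi⟩ : ∃ i, 1 ≤ w (algebraMap k M (Algebra.trace k F (e i))) := by
    by_contra! h
    have h1 : w (φ 1) < 1 := by
      rw [hex 1, map_sum]
      refine w.map_sum_lt one_ne_zero fun i _ => ?_
      rw [map_mul, φ.commutes, map_mul, map_pow, map_pow, mul_one]
      exact mul_lt_one_of_lt_of_le (h i) (pow_le_one' hpb _)
    simp at h1
  refine ⟨t • e i, ?_, ?_⟩
  · rw [Algebra.smul_def, map_mul, φ.commutes, map_mul, mul_comm]
    exact (mul_le_mul_right ht _).trans (he i)
  · rw [map_smul, smul_eq_mul, map_mul, map_mul]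
    exact le_mul_of_one_le_right' hi

end Conjugates

section Krasner

variable {K M : Type*} [Field K] [CharZero K] [Field M] [Algebra K M] [IsAlgClosed M]
  [Algebra.IsAlgebraic K M] {w : Valuation M ℝ≥0} (hinv : ∀ (σ : M ≃ₐ[K] M) x, w (σ x) = w x)
  {E : IntermediateField K M}

omit [CharZero K] [IsAlgClosed M] [Algebra.IsAlgebraic K M] in
include hinv in
theorem valuation_algEquiv_intermediateField (σ : M ≃ₐ[E] M) (x : M) : w (σ x) = w x :=
  hinv (σ.restrictScalars K) x

theorem mem_of_forall_algEquiv_eq {x : M} (h : ∀ σ : M ≃ₐ[E] M, σ x = x) : x ∈ E := by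
  have : Normal E M := normal_of_isAlgebraic_isAlgClosed
  have : IsGalois E M := ⟨⟩
  obtain ⟨y, rfl⟩ := (InfiniteGalois.mem_range_algebraMap_iff_fixed (k := E) x).2 h
  exact y.2

include hinv

theorem mem_of_valuation_sub_lt {x c : M} (hc : c ∈ E)
    (h : ∀ σ : M ≃ₐ[E] M, σ x ≠ x → w (x - c) < w (x - σ x)) : x ∈ E := by
  refine mem_of_forall_algEquiv_eq fun σ => ?_
  by_contra hσ
  refine (h σ hσ).not_ge ?_
  have h1 : w (σ x - c) = w (x - c) := by
    rw [← valuation_algEquiv_intermediateField hinv σ (x - c), map_sub σ,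
      show σ c = c from σ.commutes ⟨c, hc⟩]
  simpa using w.map_sub_le le_rfl h1.le

theorem exists_pos_forall_mem_of_valuation_sub_lt (x : M) :
    ∃ δ : ℝ≥0, 0 < δ ∧ ∀ E : IntermediateField K M, ∀ c ∈ E, w (x - c) < δ → x ∈ E := by
  classical
  let s := (((minpoly K x).map (algebraMap K M)).roots.toFinset.erase x).image fun z => w (x - z)
  have hs : ∃ δ : ℝ≥0, 0 < δ ∧ ∀ z ∈ s, δ ≤ z := by
    have hpos : ∀ z ∈ s, 0 < z := by
      intro z hz
      obtain ⟨y, hy, rfl⟩ := Finset.mem_image.1 hz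
      rw [w.pos_iff]
      exact sub_ne_zero.2 (Finset.ne_of_mem_erase hy).symm
    rcases s.eq_empty_or_nonempty with h | h
    · exact ⟨1, one_pos, by simp [h]⟩
    · exact ⟨s.min' h, hpos _ (s.min'_mem h), fun z hz => s.min'_le z hz⟩
  obtain ⟨δ, hδ, hs⟩ := hs
  refine ⟨δ, hδ, fun E c hc hlt => mem_of_valuation_sub_lt hinv hc fun σ hσ => hlt.trans_le ?_⟩
  refine hs _ (Finset.mem_image.2 ⟨σ x, Finset.mem_erase.2 ⟨hσ, ?_⟩, rfl⟩)
  have hne : (minpoly K x).map (algebraMap K M) ≠ 0 :=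
    ((minpoly.monic (Algebra.IsIntegral.isIntegral x)).map _).ne_zero
  rw [Multiset.mem_toFinset, mem_roots hne, IsRoot.def, eval_map_algebraMap]
  have := aeval_algHom_apply (σ.restrictScalars K).toAlgHom x (minpoly K x)
  rw [minpoly.aeval, map_zero] at this
  exact this

theorem IsAlmostSeparable.mem_of_valuation_sub_lt {p : ℕ} {E' : IntermediateField K M}
    (hle : E ≤ E') {τ : ℝ≥0} {G : M[X]} (hG : IsAlmostSeparable w p E τ G) (hτ : w p < τ)
    {y c : M} (hy : G.eval y = 0) (hc : c ∈ E') (h : w (y - c) < τ) : y ∈ E' := by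
  refine _root_.mem_of_valuation_sub_lt hinv hc fun σ hσ => h.trans_le ?_
  have hint := valuation_root_le_one hG.monic hG.coeff_le_one hy
  rw [← hG.valuation_derivative hτ hint]
  refine valuation_derivative_le_sub_of_roots hG.monic hG.coeff_le_one hy ?_ hσ
  have : σ (G.eval y) = G.eval (σ y) := by
    rw [eval_eq_sum_range, eval_eq_sum_range, map_sum]
    refine Finset.sum_congr rfl fun i _ => ?_
    rw [map_mul, map_pow]
    congr 1
    exact σ.commutes ⟨_, hle (hG.coeff_mem i)⟩
  rw [← this, hy, map_zero]

end Krasner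

section Tower

variable {K M : Type*} [Field K] [Field M] [Algebra K M] (w : Valuation M ℝ≥0) (p : ℕ)

/-- A sequence of approximate `p`-power roots in `K` of an element close to being a unit. -/
structure IsFrobeniusTower (t : ℕ → K) : Prop where
  lt_one : w (algebraMap K M (t 0)) < 1
  le_pow : w p ≤ w (algebraMap K M (t 0)) ^ 4
  pow_eq : ∀ n, w (algebraMap K M (t (n + 1))) ^ p = w (algebraMap K M (t n))
  sub_le : ∀ n, w (algebraMap K M (t (n + 1)) ^ p - algebraMap K M (t n)) ≤ w p

theorem valuation_prime_pos [CharZero M] [Fact p.Prime] : 0 < w (p : M) := by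
  rw [w.pos_iff]
  exact_mod_cast (Fact.out : p.Prime).ne_zero

variable {w p} [Fact p.Prime] {t : ℕ → K} (ht : IsFrobeniusTower w p t)

namespace IsFrobeniusTower

include ht

theorem valuation_lt_one (n : ℕ) : w (algebraMap K M (t n)) < 1 := by
  induction n with
  | zero => exact ht.lt_one
  | succ n ih =>
    rwa [← pow_lt_one_iff_of_nonneg zero_le (Fact.out : p.Prime).ne_zero, ht.pow_eq]

theorem le_sq (n : ℕ) : w (algebraMap K M (t n)) ≤ w (algebraMap K M (t (n + 1))) ^ 2 := by
  rw [← ht.pow_eq n]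
  exact pow_le_pow_of_le_one zero_le (ht.valuation_lt_one _).le (Fact.out : p.Prime).two_le

theorem monotone : Monotone fun n => w (algebraMap K M (t n)) :=
  monotone_nat_of_le_succ fun n => (ht.le_sq n).trans
    (pow_le_of_le_one zero_le (ht.valuation_lt_one _).le two_ne_zero)

theorem valuation_natCast_le_pow (n : ℕ) : w p ≤ w (algebraMap K M (t n)) ^ 4 :=
  ht.le_pow.trans (pow_le_pow_left₀ zero_le (ht.monotone (Nat.zero_le n)) 4)

omit [Fact p.Prime] in
theorem pow_pow_eq (n : ℕ) : w (algebraMap K M (t n)) ^ p ^ n = w (algebraMap K M (t 0)) := by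
  induction n with
  | zero => simp
  | succ n ih => rw [pow_succ', pow_mul, ht.pow_eq, ih]

variable [CharZero M]

theorem valuation_pos (n : ℕ) : 0 < w (algebraMap K M (t n)) := by
  rw [pos_iff_ne_zero]
  intro h
  have := (valuation_prime_pos w p).trans_le (ht.valuation_natCast_le_pow n)
  simp [h] at this

theorem valuation_natCast_lt_sq (n : ℕ) : w p < w (algebraMap K M (t n)) ^ 2 :=
  (ht.valuation_natCast_le_pow n).trans_lt
    (pow_lt_pow_right_of_lt_one₀ (ht.valuation_pos n) (ht.valuation_lt_one n) (by norm_num))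

theorem valuation_natCast_lt (n : ℕ) : w p < w (algebraMap K M (t n)) :=
  (ht.valuation_natCast_lt_sq n).trans_le
    (pow_le_of_le_one zero_le (ht.valuation_lt_one _).le two_ne_zero)

end IsFrobeniusTower

end Tower

section Adjoin

open IntermediateField

variable {K M : Type*} [Field K] [CharZero K] [Field M] [Algebra K M] [IsAlgClosed M]
  [Algebra.IsAlgebraic K M] {w : Valuation M ℝ≥0} {p : ℕ} [Fact p.Prime]
  {E : IntermediateField K M}

omit [CharZero K] [IsAlgClosed M] [Algebra.IsAlgebraic K M] in
theorem frobeniusSurjective_of_approx {e : M} (he : e ∈ E) (he1 : w e ≤ 1) {a : ℝ≥0}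
    (ha : a ≤ w e ^ p) (ha' : a * w e ^ p ≤ w p)
    (h : ∀ x ∈ E, w x ≤ 1 → ∃ v ∈ E, w (x - v ^ p) ≤ a) : FrobeniusSurjective w p E := by
  have hp0 : p ≠ 0 := (Fact.out : p.Prime).ne_zero
  have ha1 : a ≤ 1 := ha.trans (pow_le_one' he1 p)
  have key : ∀ x v : M, w x ≤ 1 → w (x - v ^ p) ≤ a → w v ≤ 1 := fun x v hx hv => by
    rw [← pow_le_one_iff hp0, ← map_pow]
    simpa using w.map_sub_le hx (hv.trans ha1)
  intro x hx hx1
  obtain ⟨v, hv, hxv⟩ := h x hx hx1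
  rcases eq_or_ne e 0 with rfl | he0
  · rw [map_zero, zero_pow hp0] at ha
    exact ⟨v, hv, hxv.trans (ha.trans zero_le)⟩
  have hwe : 0 < w e ^ p := pow_pos (w.pos_iff.2 he0) p
  obtain ⟨v', hv', hxv'⟩ := h ((x - v ^ p) / e ^ p)
    (div_mem (sub_mem hx (pow_mem hv p)) (pow_mem he p)) (by
      rw [map_div₀, map_pow, div_le_one hwe]; exact hxv.trans ha)
  have hv'1 : w v' ≤ 1 := key _ _ (by
      rw [map_div₀, map_pow, div_le_one hwe]; exact hxv.trans ha) hxv'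
  refine ⟨v + e * v', add_mem hv (mul_mem he hv'), ?_⟩
  have h1 : w (x - v ^ p - (e * v') ^ p) ≤ w p := by
    have : x - v ^ p - (e * v') ^ p = ((x - v ^ p) / e ^ p - v' ^ p) * e ^ p := by
      rw [sub_mul, div_mul_cancel₀ _ (pow_ne_zero p he0)]; ring
    rw [this, map_mul, map_pow w e]
    exact (mul_le_mul_left hxv' _).trans ha'
  have h2 := valuation_add_pow_sub_le p (key x v hx1 hxv)
    (y := e * v') (by rw [map_mul]; exact mul_le_one' he1 hv'1)
  convert w.map_sub_le h1 h2 using 2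
  ring

variable (hinv : ∀ (σ : M ≃ₐ[K] M) x, w (σ x) = w x) {t : ℕ → K} (ht : IsFrobeniusTower w p t)
include hinv ht

theorem frobeniusSurjective_adjoin (hE : FrobeniusSurjective w p E) {y z : M} (hy1 : w y ≤ 1)
    (hz1 : w z ≤ 1) (hz : z ∈ E⟮y⟯) {n : ℕ}
    (hd : w (algebraMap K M (t n)) ≤ w (aeval y (derivative (minpoly E y))))
    (hyz : w (y - z ^ p) * w (algebraMap K M (t n)) ≤ w p) :
    FrobeniusSurjective w p (E⟮y⟯.restrictScalars K) := by
  have : CharZero M := charZero_of_injective_algebraMap (algebraMap K M).injective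
  have hinvE := valuation_algEquiv_intermediateField hinv (E := E)
  have hyi : IsIntegral E y := Algebra.IsIntegral.isIntegral y
  obtain ⟨r, -, -, hr⟩ := exists_coeff_root hE
  set T := algebraMap K M (t n) with hT
  set T' := algebraMap K M (t (n + 1)) with hT'
  have hTT' : w T' ^ p = w T := ht.pow_eq n
  have hTpos : 0 < w T := ht.valuation_pos n
  have hpT : w p ≤ w T ^ 4 := ht.valuation_natCast_le_pow n
  have hT1 : w T ≤ 1 := (ht.valuation_lt_one n).le
  have hT'1 : w T' ≤ 1 := (ht.valuation_lt_one (n + 1)).le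
  have hT'0 : T' ≠ 0 := w.pos_iff.1 (ht.valuation_pos (n + 1))
  have hmem : ∀ a : K, algebraMap K M a ∈ E⟮y⟯.restrictScalars K := fun a =>
    (E⟮y⟯.restrictScalars K).algebraMap_mem a
  have he : (w (T' ^ 2)) ^ p = w T ^ 2 := by rw [map_pow, ← pow_mul, mul_comm, pow_mul, hTT']
  refine frobeniusSurjective_of_approx (e := T' ^ 2) (a := w p / w T ^ 2)
    (pow_mem (hmem _) 2) (by rw [map_pow]; exact pow_le_one' hT'1 2) ?_ ?_ fun x hx hx1 => ?_
  · rw [he, div_le_iff₀ (pow_pos hTpos 2), ← pow_add]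
    exact hpT
  · rw [he, div_mul_cancel₀ _ (pow_pos hTpos 2).ne']
  obtain ⟨h, hh1, hh⟩ := exists_smul_eq_sum_pow hinvE E⟮y⟯.val (adjoin.powerBasis hyi)
    (by rw [adjoin.powerBasis_gen]; exact hy1) (t := algebraMap K E (t n)) (by
      rw [adjoin.powerBasis_gen, minpoly_gen, ← aeval_algHom_apply]
      exact hd) (x := ⟨x, hx⟩) hx1
  rw [adjoin.powerBasis_gen] at hh
  have hsum : T * x = ∑ i, (h i : M) * y ^ (i : ℕ) := by
    have := congrArg E⟮y⟯.val hh
    rw [map_mul, map_sum] at this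
    simp only [map_mul, map_pow] at this
    exact this
  have hri := fun i => hr (h i) (h i).2 (hh1 i)
  set u : M := ∑ i, r (h i) * z ^ (i : ℕ) with hu
  have hu_mem : u ∈ E⟮y⟯ := sum_mem fun i _ =>
    mul_mem (E⟮y⟯.algebraMap_mem ⟨_, (hri i).1⟩) (pow_mem hz _)
  have hc : w p ≤ w p / w T := by
    rw [le_div_iff₀ hTpos]; exact mul_le_of_le_one_right' hT1
  have hyz' : w (y - z ^ p) ≤ w p / w T := by rwa [le_div_iff₀ hTpos]
  have hux : w (T * x - u ^ p) ≤ w p / w T := by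
    have h1 := (valuation_sum_pow_sub_le w p Finset.univ (fun i => r (h i) * z ^ (i : ℕ))
      fun i _ => by
        rw [map_mul, map_pow]; exact mul_le_one' (hri i).2.1 (pow_le_one' hz1 _)).trans hc
    have h2 : w (T * x - ∑ i, (r (h i) * z ^ (i : ℕ)) ^ p) ≤ w p / w T := by
      rw [hsum, ← Finset.sum_sub_distrib]
      refine w.map_sum_le fun i _ => ?_
      have h3 : w (y ^ (i : ℕ) - (z ^ p) ^ (i : ℕ)) ≤ w p / w T :=
        valuation_pow_sub_pow_le_of_sub_le hy1 (by rw [map_pow]; exact pow_le_one' hz1 _) hyz' _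
      have h4 : (h i : M) * y ^ (i : ℕ) - (r (h i) * z ^ (i : ℕ)) ^ p =
          (h i : M) * (y ^ (i : ℕ) - (z ^ p) ^ (i : ℕ)) -
            (r (h i) ^ p - h i) * (z ^ p) ^ (i : ℕ) := by ring
      rw [h4]
      refine w.map_sub_le ?_ ?_
      · rw [map_mul]; exact (mul_le_of_le_one_left' (hh1 i)).trans h3
      · rw [map_mul]
        refine (mul_le_of_le_one_right' ?_).trans ((hri i).2.2.trans hc)
        rw [map_pow, map_pow]; exact pow_le_one' (pow_le_one' hz1 _) _
    simpa using w.map_sub_le h2 h1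
  have hpT2 : w p / w T ≤ w T := by
    rw [div_le_iff₀ hTpos, ← sq]; exact (ht.valuation_natCast_lt_sq n).le
  have huT : w u ^ p ≤ w T := by
    rw [← map_pow]
    have : w (T * x) ≤ w T := by rw [map_mul]; exact mul_le_of_le_one_right' hx1
    simpa using w.map_sub_le this (hux.trans hpT2)
  refine ⟨u / T', div_mem hu_mem (hmem _), ?_⟩
  have hv : w ((u / T') ^ p) ≤ 1 := by
    rw [map_pow, map_div₀, div_pow, hTT']; exact div_le_one_of_le₀ huT zero_le
  have heq : T * (x - (u / T') ^ p) = (T * x - u ^ p) + (T' ^ p - T) * (u / T') ^ p := by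
    have h1 : T' ^ p * (u / T') ^ p = u ^ p := by rw [← mul_pow, mul_div_cancel₀ _ hT'0]
    linear_combination -h1
  rw [le_div_iff₀ (pow_pos hTpos 2), sq, ← mul_assoc, ← le_div_iff₀ hTpos, ← map_mul,
    mul_comm, heq]
  refine w.map_add_le hux ?_
  rw [map_mul]
  exact (mul_le_of_le_one_right' hv).trans ((ht.sub_le n).trans hc)

end Adjoin

section AlmostPerfect

open IntermediateField

theorem exists_forall_ge_eq_of_finrank_le {k M : Type*} [Field k] [Field M] [Algebra k M]
    {F : ℕ → IntermediateField k M} (hF : Monotone F) (hfin : ∀ n, FiniteDimensional k (F n))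
    {D : ℕ} (hD : ∀ n, Module.finrank k (F n) ≤ D) : ∃ n, ∀ m, n ≤ m → F n = F m := by
  obtain ⟨n, hn⟩ := Nat.sSup_mem (Set.range_nonempty fun n => Module.finrank k (F n))
    ⟨D, by rintro _ ⟨n, rfl⟩; exact hD n⟩
  refine ⟨n, fun m hm => ?_⟩
  have := hfin m
  refine eq_of_le_of_finrank_le (hF hm) ?_
  dsimp only at hn
  rw [hn]
  exact le_csSup ⟨D, by rintro _ ⟨n, rfl⟩; exact hD n⟩ ⟨m, rfl⟩

variable {K M : Type*} [Field K] [Field M] [Algebra K M] (w : Valuation M ℝ≥0) (p : ℕ)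
  (t : ℕ → K)

/-- A finite extension `E` of `K` with surjective Frobenius modulo `p` in which the trace to `K`
of integral elements comes arbitrarily close to being surjective. -/
structure IsAlmostPerfect (E : IntermediateField K M) : Prop where
  finite : FiniteDimensional K E
  frobenius : FrobeniusSurjective w p E
  trace : ∀ n, ∃ z : E, w z ≤ 1 ∧
    w (algebraMap K M (t n)) ≤ w (algebraMap K M (Algebra.trace K E z))

variable {w p t} [CharZero K] [IsAlgClosed M] [Algebra.IsAlgebraic K M] [Fact p.Prime]
  (hinv : ∀ (σ : M ≃ₐ[K] M) x, w (σ x) = w x) (ht : IsFrobeniusTower w p t)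
  {E : IntermediateField K M} (hE : IsAlmostPerfect w p t E)

include ht hE in
omit [IsAlgClosed M] [Algebra.IsAlgebraic K M] in
theorem IsAlmostPerfect.exists_trace_of_tower (F : IntermediateField E M) [FiniteDimensional E F]
    (hF : ∀ n, ∃ z : F, w z ≤ 1 ∧
      w (algebraMap K M (t n)) ≤ w (algebraMap E M (Algebra.trace E F z))) (n : ℕ) :
    ∃ z : F, w z ≤ 1 ∧ w (algebraMap K M (t n)) ≤ w (algebraMap K M (Algebra.trace K F z)) := by
  have : CharZero M := charZero_of_injective_algebraMap (algebraMap K M).injective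
  have := hE.finite
  obtain ⟨z₀, hz₀, hs⟩ := hF (n + 1)
  obtain ⟨z₁, hz₁, hz₁'⟩ := hE.trace (n + 1)
  have hTpos := ht.valuation_pos (n + 1)
  set s := Algebra.trace E F z₀ with hs_def
  have hs0 : s ≠ 0 := by
    intro h
    rw [h, map_zero, map_zero] at hs
    exact hs.not_gt hTpos
  set a : E := algebraMap K E (t (n + 1)) / s with ha
  have hwa : w (algebraMap E M a) ≤ 1 := by
    rw [ha, map_div₀, map_div₀, ← IsScalarTower.algebraMap_apply]
    exact div_le_one_of_le₀ hs zero_le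
  have htr : Algebra.trace E F ((a * z₁) • z₀) = algebraMap K E (t (n + 1)) * z₁ := by
    rw [map_smul, smul_eq_mul, ← hs_def, ha]
    field_simp
  refine ⟨(a * z₁) • z₀, ?_, ?_⟩
  · rw [Algebra.smul_def]
    change w (algebraMap E M (a * z₁) * z₀) ≤ 1
    rw [map_mul, map_mul, map_mul]
    exact mul_le_one' (mul_le_one' hwa hz₁) hz₀
  · rw [← Algebra.trace_trace (S := E), htr, ← Algebra.smul_def, map_smul, smul_eq_mul, map_mul,
      map_mul]
    refine (ht.le_sq n).trans ?_
    rw [sq]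
    exact mul_le_mul_right hz₁' _

include hinv ht hE in
theorem IsAlmostPerfect.exists_approx {α : M} (hα : w α ≤ 1) :
    ∃ E', IsAlmostPerfect w p t E' ∧ E ≤ E' ∧ ∃ y ∈ E', w y ≤ 1 ∧
      w (α - y) ^ (p * (minpoly E α).natDegree) ≤ w (algebraMap K M (t 0)) := by
  have : CharZero M := charZero_of_injective_algebraMap (algebraMap K M).injective
  have hp : p.Prime := Fact.out
  have hinvE := valuation_algEquiv_intermediateField hinv (E := E)
  have hint : ∀ y : M, IsIntegral E y := fun y => Algebra.IsIntegral.isIntegral y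
  let T : ℕ → M := fun n => algebraMap K M (t n)
  have hT1 : ∀ n, w (T n) ≤ 1 := fun n => (ht.valuation_lt_one n).le
  have hTE : ∀ n, T n ∈ E := fun n => E.algebraMap_mem _
  set f := (minpoly E α).map (algebraMap E M) with hf
  have hfm : f.Monic := (minpoly.monic (hint α)).map _
  have hfd : f.natDegree = (minpoly E α).natDegree := natDegree_map _
  have hfd0 : 0 < f.natDegree := hfd ▸ minpoly.natDegree_pos (hint α)
  have hfα : f.eval α = 0 := by rw [hf, eval_map_algebraMap, minpoly.aeval]
  set D := p * f.natDegree with hD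
  have hD0 : 0 < D := Nat.mul_pos hp.pos hfd0
  obtain ⟨G₀, hG₀, hG₀d, hG₀e⟩ := exists_isAlmostSeparable (w := w) (p := p) (E := E) hfm hfd0
    (fun i => by rw [hf, coeff_map]; exact Subtype.prop _)
    (fun i => by rw [hf, coeff_map]; exact valuation_coeff_minpoly_le_one hinvE hα i)
    (hTE 0) (hT1 0)
  have hG₀α : w (G₀.eval α) ≤ w (T 0) := by
    have h1 := (hG₀e α hα).trans (ht.valuation_natCast_lt 0).le
    rw [hfα, zero_pow hp.ne_zero, zero_add] at h1
    have h2 : w (T 0 * α) ≤ w (T 0) := by rw [map_mul]; exact mul_le_of_le_one_right' hα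
    simpa using w.map_add_le h1 h2
  obtain ⟨y₀, hy₀, hαy₀, -⟩ := exists_root_valuation_sub_le (w := w) hG₀.monic
    (hG₀d ▸ hD0) α
  obtain ⟨S, hS0, hS⟩ := exists_seq_of_forall_exists (α := M[X] × M)
    (P := fun n a => IsAlmostSeparable w p E (w (T n)) a.1 ∧ a.1.natDegree = D ∧
      a.1.eval a.2 = 0)
    (R := fun n a b => w (a.2 - b.2 ^ p) * w (T n) ≤ w p)
    (a := (G₀, y₀)) (by
      rintro n ⟨G, y⟩ ⟨hG, hGd, hGy⟩
      dsimp only at hG hGd hGy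
      have hy1 : w y ≤ 1 := valuation_root_le_one hG.monic hG.coeff_le_one hGy
      obtain ⟨G', hG', hGd', hGG'⟩ := hG.exists_frobenius_root hE.frobenius
        (ht.valuation_natCast_lt n) (ht.pow_eq n)
      obtain ⟨b, hb⟩ := IsAlgClosed.exists_pow_nat_eq y hp.pos
      have hb1 : w b ≤ 1 := by
        rw [← pow_le_one_iff hp.ne_zero, ← map_pow, hb]; exact hy1
      obtain ⟨y', hy', -, hby'⟩ := exists_root_valuation_sub_le (w := w) hG'.monic
        (by rw [hGd', hGd]; exact hD0) b
      have hy'1 : w y' ≤ 1 := valuation_root_le_one hG'.monic hG'.coeff_le_one hy'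
      refine ⟨(G', y'), ⟨hG', hGd'.trans hGd, hy'⟩, ?_⟩
      dsimp only
      have hTpos : 0 < w (T n) := ht.valuation_pos n
      have h1 := hGG' b hb1
      rw [hb, hGy, sub_zero, map_pow] at h1
      rw [hG'.valuation_derivative (ht.valuation_natCast_lt (n + 1)) hy'1] at hby'
      have h2 := (pow_le_pow_left₀ zero_le hby' p).trans h1
      rw [mul_pow, ht.pow_eq, ← le_div_iff₀ hTpos] at h2
      rw [← le_div_iff₀ hTpos, ← hb]
      refine valuation_pow_sub_pow_le p hb1 hy'1 ?_ h2
      rw [le_div_iff₀ hTpos]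
      exact mul_le_of_le_one_right' (hT1 n))
    ⟨hG₀, hG₀d, hy₀⟩
  have hy₀S : (S 0).2 = y₀ := by rw [hS0]
  have hSep := fun n => (hS n).1.1
  have hroot := fun n => (hS n).1.2.2
  have hrel := fun n => (hS n).2
  have hS1 : ∀ n, w (S n).2 ≤ 1 := fun n =>
    valuation_root_le_one (hSep n).monic (hSep n).coeff_le_one (hroot n)
  have hder : ∀ n, w ((S n).1.derivative.eval (S n).2) = w (T n) := fun n =>
    (hSep n).valuation_derivative (ht.valuation_natCast_lt n) (hS1 n)
  let F : ℕ → IntermediateField E M := fun n => E⟮(S n).2⟯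
  have hfin : ∀ n, FiniteDimensional E (F n) := fun n => adjoin.finiteDimensional (hint _)
  have hlift : ∀ n, ∃ g : E[X], g.map (algebraMap E M) = (S n).1 ∧ g.Monic := fun n => by
    have hl : (S n).1 ∈ lifts (algebraMap E M) :=
      (lifts_iff_coeff_lifts _).2 fun i => ⟨⟨_, (hSep n).coeff_mem i⟩, rfl⟩
    obtain ⟨q, hq, -, hqm⟩ := lifts_and_natDegree_eq_and_monic hl (hSep n).monic
    exact ⟨q, hq, hqm⟩
  choose g hg hgm using hlift
  have hgroot : ∀ n, aeval (S n).2 (g n) = 0 := fun n => by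
    rw [← eval_map_algebraMap, hg, hroot]
  have hmin : ∀ n, w (T n) ≤ w (aeval (S n).2 (derivative (minpoly E (S n).2))) := fun n => by
    rw [← hder, ← hg, derivative_map, eval_map_algebraMap]
    exact valuation_aeval_derivative_le (hgm n)
      (fun i => by rw [← coeff_map, hg]; exact (hSep n).coeff_le_one i) (hgroot n)
  have hstep : ∀ n, (S n).2 ∈ F (n + 1) := fun n => by
    have hTpos : 0 < w (T n) := ht.valuation_pos n
    refine (hSep n).mem_of_valuation_sub_lt hinv (E' := (F (n + 1)).restrictScalars K)
      (c := (S (n + 1)).2 ^ p) (fun x hx => (F (n + 1)).algebraMap_mem ⟨x, hx⟩)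
      (ht.valuation_natCast_lt n) (hroot n) (pow_mem (mem_adjoin_simple_self E _) p) ?_
    refine lt_of_mul_lt_mul_of_nonneg_right ((hrel n).trans_lt ?_) hTpos.le
    rw [← sq]
    exact ht.valuation_natCast_lt_sq n
  have hmono : Monotone F := monotone_nat_of_le_succ fun n =>
    (adjoin_simple_le_iff).2 (hstep n)
  obtain ⟨N, hN⟩ := exists_forall_ge_eq_of_finrank_le hmono hfin (D := D) fun n => by
    rw [adjoin.finrank (hint _), ← (hS n).1.2.1, ← hg, natDegree_map]
    exact natDegree_le_of_dvd (minpoly.dvd E _ (hgroot n)) (hgm n).ne_zero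
  have hfinN := hfin N
  have := hE.finite
  refine ⟨(F N).restrictScalars K, ⟨?_, ?_, ?_⟩, fun x hx => (F N).algebraMap_mem ⟨x, hx⟩,
    y₀, ?_, ?_, ?_⟩
  · exact Module.Finite.trans (R := K) E (F N)
  · refine frobeniusSurjective_adjoin hinv ht hE.frobenius (hS1 N) (hS1 (N + 1)) ?_ (hmin N)
      (hrel N)
    change _ ∈ F N
    rw [hN (N + 1) (Nat.le_succ N)]
    exact mem_adjoin_simple_self E _
  · refine hE.exists_trace_of_tower ht (F N) fun n => ?_
    obtain ⟨m, hm, hNm⟩ : ∃ m, n ≤ m ∧ F N = F m := ⟨max n N, le_max_left _ _, hN _ (le_max_right _ _)⟩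
    rw [hNm]
    obtain ⟨z, hz, hzt⟩ := exists_valuation_le_trace hinvE (F m).val (adjoin.powerBasis (hint _))
      (by rw [adjoin.powerBasis_gen]; exact hS1 m) (t := algebraMap K E (t m)) (by
        rw [adjoin.powerBasis_gen, minpoly_gen, ← aeval_algHom_apply]
        exact hmin m)
    exact ⟨z, hz, (ht.monotone hm).trans hzt⟩
  · exact hmono (Nat.zero_le N) (hy₀S ▸ mem_adjoin_simple_self E (S 0).2)
  · exact hy₀S ▸ hS1 0
  · rw [← hfd, ← hG₀d]
    exact hαy₀.trans hG₀α

end AlmostPerfect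

section Exhaustion

open IntermediateField

variable {K M : Type*} [Field K] [Field M] [Algebra K M] {w : Valuation M ℝ≥0} {p : ℕ}
  {t : ℕ → K} [CharZero K] [IsAlgClosed M] [Algebra.IsAlgebraic K M] [Fact p.Prime]
  (hinv : ∀ (σ : M ≃ₐ[K] M) x, w (σ x) = w x) (ht : IsFrobeniusTower w p t)
  (hbot : FrobeniusSurjective w p (⊥ : IntermediateField K M))

include ht hbot in
omit [CharZero K] [IsAlgClosed M] [Algebra.IsAlgebraic K M] in
theorem isAlmostPerfect_bot : IsAlmostPerfect w p t (⊥ : IntermediateField K M) where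
  finite := inferInstance
  frobenius := hbot
  trace n := by
    refine ⟨1, by simp, ?_⟩
    have : Algebra.trace K (⊥ : IntermediateField K M) 1 = 1 := by
      rw [← map_one (algebraMap K _), Algebra.trace_algebraMap]; simp
    rw [this, map_one, map_one]
    exact (ht.valuation_lt_one n).le

omit [CharZero K] [IsAlgClosed M] in
theorem natDegree_minpoly_affine_le (E : IntermediateField K M) (α : M) {y c : M} (hy : y ∈ E)
    (hc : c ∈ E) (hc0 : c ≠ 0) :
    (minpoly E ((α - y) / c)).natDegree ≤ (minpoly K α).natDegree := by
  set l : E[X] := C ⟨c, hc⟩ * X + C ⟨y, hy⟩ with hl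
  have hc0' : (⟨c, hc⟩ : E) ≠ 0 := fun h => hc0 (congrArg Subtype.val h)
  have hld : l.natDegree = 1 := natDegree_linear hc0'
  set q := ((minpoly K α).map (algebraMap K E)).comp l with hq
  have hqd : q.natDegree = (minpoly K α).natDegree := by
    rw [hq, natDegree_comp, hld, mul_one, natDegree_map]
  have hq0 : q ≠ 0 := by
    intro h
    have := minpoly.natDegree_pos (Algebra.IsIntegral.isIntegral (R := K) α)
    rw [← hqd, h, natDegree_zero] at this
    exact this.false
  rw [← hqd]
  refine natDegree_le_of_dvd (minpoly.dvd E _ ?_) hq0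
  have h1 : aeval ((α - y) / c) l = α := by
    have h2 : aeval ((α - y) / c) l = c * ((α - y) / c) + y := by
      rw [hl, map_add, map_mul, aeval_X, aeval_C, aeval_C]; rfl
    rw [h2, mul_div_cancel₀ _ hc0]; ring
  rw [hq, aeval_comp, h1, aeval_map_algebraMap, minpoly.aeval]

include hinv ht hbot

theorem exists_isAlmostPerfect_mem {α : M} (hα : w α ≤ 1) :
    ∃ E : IntermediateField K M, IsAlmostPerfect w p t E ∧ α ∈ E := by
  have : CharZero M := charZero_of_injective_algebraMap (algebraMap K M).injective
  have hp : p.Prime := Fact.out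
  set d := (minpoly K α).natDegree with hd
  set T := algebraMap K M (t (p * d)) with hT
  have hT1 : w T < 1 := ht.valuation_lt_one _
  have hTpos : 0 < w T := ht.valuation_pos _
  have hT0 : T ≠ 0 := w.pos_iff.1 hTpos
  have ht0 : w (algebraMap K M (t 0)) ≤ w T ^ (p * d) := by
    rw [← ht.pow_pow_eq (p * d)]
    exact pow_le_pow_of_le_one zero_le hT1.le (Nat.lt_pow_self hp.one_lt).le
  have key : ∀ j : ℕ, ∃ E : IntermediateField K M, IsAlmostPerfect w p t E ∧
      ∃ y ∈ E, w (α - y) ≤ w T ^ j := fun j => by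
    induction j with
    | zero => exact ⟨⊥, isAlmostPerfect_bot ht hbot, 0, zero_mem _, by simpa using hα⟩
    | succ j ih =>
      obtain ⟨E, hE, y, hy, hαy⟩ := ih
      have hTj : T ^ j ∈ E := pow_mem (E.algebraMap_mem _) j
      have hTj0 : T ^ j ≠ 0 := pow_ne_zero j hT0
      obtain ⟨E', hE', hEE', y', hy', -, hyy'⟩ := hE.exists_approx hinv ht (α := (α - y) / T ^ j)
        (by rw [map_div₀, map_pow]; exact div_le_one_of_le₀ hαy zero_le)
      have hdeg := natDegree_minpoly_affine_le E α hy hTj hTj0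
      have hpos : p * (minpoly E ((α - y) / T ^ j)).natDegree ≠ 0 :=
        (Nat.mul_pos hp.pos (minpoly.natDegree_pos (Algebra.IsIntegral.isIntegral _))).ne'
      have hle : w ((α - y) / T ^ j - y') ≤ w T := by
        refine le_of_pow_le_pow_left₀ hpos zero_le (hyy'.trans (ht0.trans ?_))
        exact pow_le_pow_of_le_one zero_le hT1.le (Nat.mul_le_mul_left p hdeg)
      refine ⟨E', hE', y + T ^ j * y', add_mem (hEE' hy) (mul_mem (hEE' hTj) hy'), ?_⟩
      have heq : α - (y + T ^ j * y') = T ^ j * ((α - y) / T ^ j - y') := by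
        rw [mul_sub, mul_div_cancel₀ _ hTj0]; ring
      rw [heq, map_mul, map_pow, pow_succ]
      exact mul_le_mul_right hle _
  obtain ⟨δ, hδ, hmem⟩ := exists_pos_forall_mem_of_valuation_sub_lt hinv α
  obtain ⟨j, hj⟩ := exists_pow_lt_of_lt_one hδ hT1
  obtain ⟨E, hE, y, hy, hαy⟩ := key j
  exact ⟨E, hE, hmem E y hy (hαy.trans_lt hj)⟩

end Exhaustion

section Descent

open IntermediateField

theorem exists_valuation_mem_Ioo {K : Type*} [Field K] (v : Valuation K ℝ≥0) {c : K} (hc0 : c ≠ 0)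
    (hc : v c < 1) (h : ¬ ∃ γ : ℝ≥0, γ < 1 ∧ ∀ x : K, x ≠ 0 → ∃ n : ℤ, v x = γ ^ n) :
    ∃ t : K, v c < v t ∧ v t < 1 := by
  have hcpos : 0 < v c := v.pos_iff.2 hc0
  by_contra! H
  refine h ⟨v c, hc, fun x hx => ?_⟩
  obtain ⟨n, hn1, hn2⟩ := exists_mem_Ioc_zpow (v.pos_iff.2 hx) ((one_lt_inv₀ hcpos).2 hc)
  refine ⟨-(n + 1), ?_⟩
  rw [inv_zpow', neg_add] at hn2
  rw [inv_zpow'] at hn1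
  have h1 : v (x / c ^ (-(n + 1))) ≤ 1 := by
    rw [map_div₀, map_zpow₀]
    refine div_le_one_of_le₀ ?_ zero_le
    rwa [neg_add]
  have h2 : v c < v (x / c ^ (-(n + 1))) := by
    rw [map_div₀, map_zpow₀, lt_div_iff₀ (zpow_pos hcpos _), ← zpow_one_add₀ hcpos.ne']
    convert hn1 using 2
    ring
  have h3 := le_antisymm h1 (H _ h2)
  rw [map_div₀, map_zpow₀, div_eq_one_iff_eq (zpow_pos hcpos _).ne'] at h3
  exact h3

variable {K M : Type*} [Field K] [Field M] [Algebra K M] {w : Valuation M ℝ≥0} {p : ℕ}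
  [Fact p.Prime]

theorem exists_isFrobeniusTower (hbot : FrobeniusSurjective w p (⊥ : IntermediateField K M))
    {t₀ : K} (h0 : w p < w (algebraMap K M t₀)) (h1 : w (algebraMap K M t₀) < 1) :
    ∃ t : ℕ → K, IsFrobeniusTower w p t := by
  have hp : p.Prime := Fact.out
  have hpow : ∀ a b : K, w p < w (algebraMap K M a) →
      w (algebraMap K M b ^ p - algebraMap K M a) ≤ w p →
      w (algebraMap K M b) ^ p = w (algebraMap K M a) := fun a b ha hab => by
    rw [← map_pow]; exact eq_of_valuation_sub_lt (hab.trans_lt ha)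
  obtain ⟨s, hs0, hs⟩ := exists_seq_of_forall_exists (α := K)
    (P := fun _ a => w p < w (algebraMap K M a) ∧ w (algebraMap K M a) < 1)
    (R := fun _ a b => w (algebraMap K M b ^ p - algebraMap K M a) ≤ w p) (a := t₀) (by
      rintro - a ⟨ha, ha1⟩
      obtain ⟨y, hy, hay⟩ := hbot _ ((⊥ : IntermediateField K M).algebraMap_mem a) ha1.le
      obtain ⟨b, rfl⟩ := mem_bot.1 hy
      rw [← neg_sub, w.map_neg] at hay
      have hb := hpow a b ha hay
      have hb1 : w (algebraMap K M b) < 1 := by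
        rwa [← pow_lt_one_iff_of_nonneg zero_le hp.ne_zero, hb]
      exact ⟨b, ⟨ha.trans_le (hb ▸ pow_le_of_le_one zero_le hb1.le hp.ne_zero), hb1⟩, hay⟩)
    ⟨h0, h1⟩
  have hpow' := fun n => hpow _ _ (hs n).1.1 (hs n).2
  refine ⟨fun n => s (n + 2), (hs 2).1.2, ?_, fun n => hpow' _, fun n => (hs _).2⟩
  refine (hs 0).1.1.le.trans ?_
  rw [← hpow', ← hpow', ← pow_mul]
  refine pow_le_pow_of_le_one zero_le (hs 2).1.2.le ?_
  nlinarith [hp.two_le]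

variable [CharZero K] [IsAlgClosed M] [Algebra.IsAlgebraic K M] {t : ℕ → K}
  (hinv : ∀ (σ : M ≃ₐ[K] M) x, w (σ x) = w x) (ht : IsFrobeniusTower w p t)
include hinv ht

theorem IsAlmostPerfect.exists_approx_root {E L : IntermediateField K M}
    (hE : IsAlmostPerfect w p t E) (hL : L ≤ E) {x : M} (hx : x ∈ L) (hx1 : w x ≤ 1) :
    ∃ y ∈ L, w y ≤ 1 ∧ w (x - y ^ p) ≤ w (algebraMap K M (t 0)) := by
  have : CharZero M := charZero_of_injective_algebraMap (algebraMap K M).injective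
  have hp : p.Prime := Fact.out
  have hinvL := valuation_algEquiv_intermediateField hinv (E := L)
  have hfinE := hE.finite
  let F : IntermediateField L M := extendScalars hL
  have hfinF : FiniteDimensional K F := hE.finite
  have hfinLF : FiniteDimensional L F := FiniteDimensional.right K L F
  have hfinL : FiniteDimensional K L := FiniteDimensional.left K L F
  obtain ⟨z, hz, hzt⟩ : ∃ z : F, w z ≤ 1 ∧
    w (algebraMap K M (t 1)) ≤ w (algebraMap K M (Algebra.trace K F z)) := hE.trace 1
  obtain ⟨y₀, hy₀, hxy₀⟩ := hE.frobenius x (hL hx) hx1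
  have hpt := (ht.valuation_natCast_lt 0).le
  have ht1 := ht.valuation_lt_one 0
  have htpos := ht.valuation_pos 0
  have hp1 := valuation_natCast_le_one w p
  have hy₀1 : w y₀ ≤ 1 := by
    rw [← pow_le_one_iff hp.ne_zero, ← map_pow]
    simpa using w.map_sub_le hx1 (hxy₀.trans hp1)
  set y : F := ⟨y₀, hy₀⟩ with hy
  set s := Algebra.trace L F z with hs
  have hst : w (algebraMap K M (t 1)) ≤ w s := by
    refine hzt.trans ?_
    rw [← Algebra.trace_trace (S := L)]
    exact valuation_trace_le hinv L.val le_rfl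
  have hs0 : (s : M) ≠ 0 := w.pos_iff.1 ((ht.valuation_pos 1).trans_le hst)
  have hspos : 0 < w (s : M) := w.pos_iff.2 hs0
  obtain ⟨π, hπ⟩ := IsAlgClosed.exists_pow_nat_eq (p : M) hp.pos
  have hπp : w π ^ p = w p := by rw [← map_pow, hπ]
  have hconj : ∀ σ : F →ₐ[L] M, w (σ y - y) ≤ w π := fun σ => by
    rw [← pow_le_pow_iff_left₀ zero_le zero_le hp.ne_zero, hπp]
    have hσy : w (σ y) ≤ 1 := (valuation_algHom_eq hinvL σ F.val y).trans_le hy₀1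
    refine valuation_sub_pow_le p hσy hy₀1 le_rfl ?_
    have h1 : w (σ (y ^ p - algebraMap L F ⟨x, hx⟩)) ≤ w p := by
      rw [valuation_algHom_eq hinvL σ F.val, ← w.map_neg]
      convert hxy₀ using 2
      simp [hy]
    rw [map_sub, map_pow, σ.commutes] at h1
    have h2 := w.map_sub_le h1 (g := w p) (x := σ y ^ p - x) (y := y₀ ^ p - x) (by
      rw [← w.map_neg]; simpa using hxy₀)
    simpa using h2
  set a := Algebra.trace L F (z * y) with ha
  have hdiff : w ((a : M) - s * y₀) ≤ w π := by
    have h1 : (a : M) = ∑ σ : F →ₐ[L] M, σ (z * y) :=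
      trace_eq_sum_embeddings (K := L) (L := F) M (x := z * y)
    have h2 : (s : M) = ∑ σ : F →ₐ[L] M, σ z :=
      trace_eq_sum_embeddings (K := L) (L := F) M (x := z)
    rw [h1, h2, Finset.sum_mul, ← Finset.sum_sub_distrib]
    refine w.map_sum_le fun σ _ => ?_
    rw [map_mul, ← mul_sub, map_mul]
    refine (mul_le_of_le_one_left' ?_).trans (hconj σ)
    rw [valuation_algHom_eq hinvL σ F.val]
    exact hz
  have hdiff' : w ((a : M) / s - y₀) ^ p ≤ w (algebraMap K M (t 0)) := by
    have h1 : w ((a : M) / s - y₀) * w (s : M) ≤ w π := by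
      rw [← map_mul, sub_mul, div_mul_cancel₀ _ hs0, mul_comm y₀]
      exact hdiff
    have h2 := pow_le_pow_left₀ zero_le h1 p
    rw [mul_pow, hπp] at h2
    have h3 : w (algebraMap K M (t 0)) ≤ w (s : M) ^ p := by
      rw [← ht.pow_eq 0]; exact pow_le_pow_left₀ zero_le hst p
    refine le_of_mul_le_mul_right ((mul_le_mul_right h3 _).trans (h2.trans ?_)) htpos
    rw [← sq]
    exact (ht.valuation_natCast_lt_sq 0).le
  have hy'1 : w ((a : M) / s) ≤ 1 := by
    have h1 : w ((a : M) / s - y₀) ≤ 1 :=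
      (pow_le_one_iff hp.ne_zero).1 (hdiff'.trans ht1.le)
    simpa using w.map_add_le h1 hy₀1
  refine ⟨(a : M) / s, div_mem a.2 s.2, hy'1, ?_⟩
  have h1 := valuation_pow_sub_pow_le p hy'1 hy₀1 hpt hdiff'
  simpa using w.map_sub_le (hxy₀.trans hpt) h1

end Descent

section Kaehler

variable {A B : Type*} [CommRing A] [CommRing B] [Algebra A B]

theorem kaehlerDifferential_subsingleton_of_pow_smul_eq_zero (p : ℕ) {c : A} (hc : c ∣ p)
    (h : ∀ x : B, ∃ y z : B, x = y ^ p + c • z) {N : ℕ}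
    (hN : ∀ x : B, c ^ N • KaehlerDifferential.D A B x = 0) : Subsingleton Ω[B⁄A] := by
  have hdiv : ∀ ω : Ω[B⁄A], ∃ η : Ω[B⁄A], ω = c • η := by
    intro ω
    have hω : ω ∈ Submodule.span B (Set.range (KaehlerDifferential.D A B)) := by
      rw [KaehlerDifferential.span_range_derivation]; trivial
    induction hω using Submodule.span_induction with
    | mem ω hω =>
      obtain ⟨x, rfl⟩ := hω
      obtain ⟨y, z, rfl⟩ := h x
      obtain ⟨d, hd⟩ := hc
      refine ⟨d • y ^ (p - 1) • KaehlerDifferential.D A B y + KaehlerDifferential.D A B z, ?_⟩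
      rw [map_add, Derivation.leibniz_pow, Derivation.map_smul, smul_add, smul_smul, ← hd,
        Nat.cast_smul_eq_nsmul]
    | zero => exact ⟨0, by simp⟩
    | add x y _ _ hx hy =>
      obtain ⟨a, rfl⟩ := hx
      obtain ⟨b, rfl⟩ := hy
      exact ⟨a + b, (smul_add _ _ _).symm⟩
    | smul b x _ hx =>
      obtain ⟨a, rfl⟩ := hx
      exact ⟨b • a, smul_comm _ _ _⟩
  have hdivN : ∀ n : ℕ, ∀ ω : Ω[B⁄A], ∃ η : Ω[B⁄A], ω = c ^ n • η := fun n => by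
    induction n with
    | zero => exact fun ω => ⟨ω, by simp⟩
    | succ n ih =>
      intro ω
      obtain ⟨η, rfl⟩ := ih ω
      obtain ⟨θ, rfl⟩ := hdiv η
      exact ⟨θ, by rw [smul_smul, pow_succ]⟩
  have hann : ∀ ω : Ω[B⁄A], c ^ N • ω = 0 := by
    intro ω
    have hω : ω ∈ Submodule.span B (Set.range (KaehlerDifferential.D A B)) := by
      rw [KaehlerDifferential.span_range_derivation]; trivial
    induction hω using Submodule.span_induction with
    | mem ω hω =>
      obtain ⟨x, rfl⟩ := hω
      exact hN x
    | zero => simp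
    | add x y _ _ hx hy => rw [smul_add, hx, hy, add_zero]
    | smul b x _ hx => rw [smul_comm, hx, smul_zero]
  refine ⟨fun ω ω' => ?_⟩
  obtain ⟨η, rfl⟩ := hdivN N ω
  obtain ⟨η', rfl⟩ := hdivN N ω'
  rw [hann, hann]

theorem smul_smul_derivation_eq_zero {a : A} {α : B} {g : A[X]} (hg : aeval α g = 0) {u : B}
    (hu : algebraMap A B a = u * aeval α (derivative g)) {x : B} {q : A[X]}
    (hq : a • x = aeval α q) : (a * a) • KaehlerDifferential.D A B x = 0 := by
  have h1 : a • KaehlerDifferential.D A B α = 0 := by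
    rw [← algebraMap_smul B, hu, mul_smul, ← Derivation.map_aeval, hg, map_zero, smul_zero]
  rw [mul_smul, ← Derivation.map_smul, hq, Derivation.map_aeval, smul_comm, h1, smul_zero]

end Kaehler

section Comparison

theorem le_one_of_forall_le_one {L : Type*} [Field L] {v₁ v₂ : Valuation L ℝ≥0}
    (h : ∀ x, v₂ x ≤ 1 → v₁ x ≤ 1) {c : L} (hc0 : c ≠ 0) (hc : v₁ c < 1) {x : L}
    (hx : v₁ x ≤ 1) : v₂ x ≤ 1 := by
  by_contra! hlt
  have hx0 : x ≠ 0 := by rintro rfl; simp at hlt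
  obtain ⟨n, hn⟩ := exists_pow_lt_of_lt_one (v₂.pos_iff.2 hc0) (inv_lt_one_of_one_lt₀ hlt)
  have h1 : v₁ ((x⁻¹) ^ n / c) ≤ 1 := h _ (by
    rw [map_div₀, map_pow, map_inv₀]; exact div_le_one_of_le₀ hn.le zero_le)
  rw [map_div₀, map_pow, map_inv₀, div_le_one (v₁.pos_iff.2 hc0)] at h1
  refine (h1.trans_lt hc).not_ge (one_le_pow₀ ?_)
  exact (one_le_inv₀ (v₁.pos_iff.2 hx0)).2 hx

theorem charZero_of_valuation_natCast_lt_one {K : Type*} [Field K] (v : Valuation K ℝ≥0) {p : ℕ}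
    [Fact p.Prime] (h0 : v p ≠ 0) (h1 : v p < 1) : CharZero K := by
  have hp : p.Prime := Fact.out
  rcases CharP.exists' K with h | ⟨q, hq, hqK⟩
  · exact h
  have hpq : p ≠ q := by
    rintro rfl
    simp at h0
  obtain ⟨a, b, hab⟩ := Nat.isCoprime_iff_coprime.2 ((Nat.coprime_primes hp hq.out).2 hpq)
  have hab' : (a : K) * p = 1 := by
    have := congrArg (Int.cast : ℤ → K) hab
    push_cast at this
    simpa using this
  have ha : v (a : K) ≤ 1 := by
    obtain ⟨n, rfl | rfl⟩ := a.eq_nat_or_neg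
    · simpa using valuation_natCast_le_one v n
    · simpa using valuation_natCast_le_one v n
  have := congrArg v hab'
  rw [map_mul, map_one] at this
  exact absurd this ((mul_le_of_le_one_left' ha).trans_lt h1).ne

theorem exists_powerBasis_valuation_le_one {K L : Type*} [Field K] [CharZero K] [Field L]
    [Algebra K L] [FiniteDimensional K L] (v : Valuation L ℝ≥0) {c : K} (hc0 : c ≠ 0)
    (hc : v (algebraMap K L c) < 1) : ∃ pb : PowerBasis K L, v pb.gen ≤ 1 := by
  let pb := Field.powerBasisOfFiniteOfSeparable K L
  have hg : ∃ n : ℕ, v (algebraMap K L c) ^ n * v pb.gen ≤ 1 := by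
    rcases eq_or_ne pb.gen 0 with h | h
    · exact ⟨0, by simp [h]⟩
    · have h0 := v.pos_iff.2 h
      obtain ⟨n, hn⟩ := exists_pow_lt_of_lt_one (inv_pos.2 h0) hc
      exact ⟨n, (mul_le_mul_left hn.le _).trans_eq (inv_mul_cancel₀ h0.ne')⟩
  obtain ⟨n, hn⟩ := hg
  have htop : Algebra.adjoin K {c ^ n • pb.gen} = ⊤ := by
    rw [eq_top_iff, ← pb.adjoin_gen_eq_top]
    refine Algebra.adjoin_le (Set.singleton_subset_iff.2 ?_)
    have h := Subalgebra.smul_mem (Algebra.adjoin K {c ^ n • pb.gen})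
      (Algebra.self_mem_adjoin_singleton K (c ^ n • pb.gen)) (c ^ n)⁻¹
    rwa [inv_smul_smul₀ (pow_ne_zero n hc0)] at h
  refine ⟨PowerBasis.ofAdjoinEqTop (Algebra.IsIntegral.isIntegral _) htop, ?_⟩
  rw [PowerBasis.ofAdjoinEqTop_gen, Algebra.smul_def, map_mul, map_pow, map_pow]
  exact hn

end Comparison

section Assembly

theorem frobeniusSurjective_bot {p : ℕ} [Fact p.Prime] {K : Type*} [Field K] [Valued K ℝ≥0]
    (hfrob : ∀ a : OKmodp p K, ∃ b, b ^ p = a) {M : Type*} [Field M] [Algebra K M]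
    {w : Valuation M ℝ≥0} (hw : ∀ x : K, w (algebraMap K M x) = Valued.v x) :
    FrobeniusSurjective w p (⊥ : IntermediateField K M) := by
  intro x hx hx1
  obtain ⟨a, rfl⟩ := IntermediateField.mem_bot.1 hx
  rw [hw] at hx1
  obtain ⟨b, hb⟩ := hfrob (Ideal.Quotient.mk _ ⟨a, hx1⟩)
  obtain ⟨b, rfl⟩ := Ideal.Quotient.mk_surjective b
  rw [← map_pow, eq_comm, Ideal.Quotient.eq, Ideal.mem_span_singleton'] at hb
  obtain ⟨d, hd⟩ := hb
  have hd' : (d : K) * p = a - (b : K) ^ p := congrArg Subtype.val hd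
  refine ⟨algebraMap K M b, IntermediateField.algebraMap_mem _ _, ?_⟩
  rw [← map_pow, ← map_sub, ← hd', map_mul, map_natCast, map_mul, hw]
  exact mul_le_of_le_one_left' d.2

theorem valuation_le_one_of_algHom {K L M : Type*} [Field K] [CharZero K] [Field L] [Field M]
    [Algebra K L] [Algebra K M] [FiniteDimensional K L] [IsAlgClosed M] [Algebra.IsAlgebraic K M]
    {w : Valuation M ℝ≥0} (hinv : ∀ (σ : M ≃ₐ[K] M) (x : M), w (σ x) = w x)
    {v : Valuation L ℝ≥0} (hv : ∀ x : K, v (algebraMap K L x) = w (algebraMap K M x))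
    (φ : L →ₐ[K] M) {x : L} (hx : w (φ x) ≤ 1) : v x ≤ 1 := by
  have hint : IsIntegral K x := Algebra.IsIntegral.isIntegral x
  refine valuation_root_le_one (G := (minpoly K x).map (algebraMap K L))
    ((minpoly.monic hint).map _) (fun i => ?_) ?_
  · rw [coeff_map, hv, ← minpoly.algHom_eq φ φ.injective]
    exact valuation_coeff_minpoly_le_one hinv hx i
  · rw [eval_map_algebraMap, minpoly.aeval]

theorem exists_polynomial_integer {K : Type*} [Field K] [Valued K ℝ≥0] {G : K[X]}
    (hG : ∀ i, Valued.v (G.coeff i) ≤ 1) : ∃ g : (OK K)[X], g.map (OK K).subtype = G := by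
  have : G ∈ lifts (OK K).subtype := by
    rw [lifts_iff_coeff_lifts]
    exact fun i => ⟨⟨G.coeff i, hG i⟩, rfl⟩
  exact (mem_lifts _).1 this

theorem coe_aeval_integer {K L : Type*} [Field K] [Valued K ℝ≥0] [Field L] [Algebra K L]
    [Valued L ℝ≥0] [Algebra (OK K) (OK L)]
    (halg : ∀ x : OK K, ((algebraMap (OK K) (OK L) x : OK L) : L) = algebraMap K L (x : K))
    (g : (OK K)[X]) (α : OK L) :
    ((aeval α g : OK L) : L) = aeval (α : L) (g.map (OK K).subtype) := by
  have h : (OK L).subtype.comp (algebraMap (OK K) (OK L)) =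
      (algebraMap K L).comp (OK K).subtype := RingHom.ext halg
  rw [aeval_def, aeval_def, eval₂_map, ← h, ← Subring.subtype_apply, hom_eval₂]
  rfl

end Assembly

/-- Every perfectoid analytic field `K` is deeply ramified: for every finite extension
`L` of `K` (with its unique extension of the norm), the module of Kähler differentials
`Ω_{o_L/o_K}` vanishes. -/
theorem perfectoid_deeply_ramified (p : ℕ) [Fact p.Prime] (K : Type*) [Field K]
    [Valued K ℝ≥0] [CompleteSpace K]
    (hp : Valued.v (p : K) = (p : ℝ≥0)⁻¹)
    (hnd : ¬ IsDiscretelyValued K)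
    (hfrob : ∀ a : OKmodp p K, ∃ b, b ^ p = a)
    (L : Type*) [Field L] [Algebra K L] [FiniteDimensional K L]
    [Valued L ℝ≥0]
    (hext : ∀ x : K, Valued.v (algebraMap K L x) = Valued.v x)
    [Algebra (OK K) (OK L)]
    (halg : ∀ x : OK K, ((algebraMap (OK K) (OK L) x : OK L) : L) = algebraMap K L (x : K)) :
    Subsingleton (Ω[(OK L)⁄(OK K)]) := by
  have hp0 : (Valued.v (p : K) : ℝ≥0) ≠ 0 := by
    rw [hp]
    exact inv_ne_zero (Nat.cast_ne_zero.2 (Fact.out : p.Prime).ne_zero)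
  have hp1 : (Valued.v (p : K) : ℝ≥0) < 1 := by
    rw [hp]
    exact inv_lt_one_of_one_lt₀ (Nat.one_lt_cast.2 (Fact.out : p.Prime).one_lt)
  have hpK : (p : K) ≠ 0 := (Valuation.ne_zero_iff _).1 hp0
  have : CharZero K := charZero_of_valuation_natCast_lt_one Valued.v hp0 hp1
  obtain ⟨w, hinv, hw⟩ := exists_galois_invariant_valuation K ⟨p, hp0, hp1.ne⟩
  have hwp : w p = Valued.v (p : K) := by rw [← hw, map_natCast (algebraMap K _)]
  have hbot := frobeniusSurjective_bot hfrob hw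
  obtain ⟨t₀, ht₀, ht₀'⟩ := exists_valuation_mem_Ioo (Valued.v : Valuation K ℝ≥0) hpK hp1 hnd
  rw [← hwp, ← hw] at ht₀
  rw [← hw] at ht₀'
  obtain ⟨t, ht⟩ := exists_isFrobeniusTower hbot ht₀ ht₀'
  let φ : L →ₐ[K] AlgebraicClosure K := IsAlgClosed.lift
  have hv (x : K) : Valued.v (algebraMap K L x) = w (algebraMap K _ x) := by rw [hext, hw]
  have hvw {x : L} (hx : w (φ x) ≤ 1) : Valued.v x ≤ (1 : ℝ≥0) :=
    valuation_le_one_of_algHom hinv hv φ hx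
  have hpL : Valued.v (algebraMap K L p) < (1 : ℝ≥0) := by rwa [hext]
  have hwv {x : L} (hx : Valued.v x ≤ (1 : ℝ≥0)) : w (φ x) ≤ 1 :=
    le_one_of_forall_le_one (v₂ := w.comap (φ : L →+* AlgebraicClosure K)) (fun _ h => hvw h)
      ((_root_.map_ne_zero (algebraMap K L)).2 hpK) hpL hx
  obtain ⟨pb, hpb⟩ := exists_powerBasis_valuation_le_one (Valued.v : Valuation L ℝ≥0) hpK hpL
  obtain ⟨E, hE, hgE⟩ := exists_isAlmostPerfect_mem hinv ht hbot (hwv hpb)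
  have hLE : φ.fieldRange ≤ E := by
    rintro _ ⟨x, rfl⟩
    have h : Algebra.adjoin K {pb.gen} ≤ E.toSubalgebra.comap φ :=
      Algebra.adjoin_le (Set.singleton_subset_iff.2 hgE)
    rw [pb.adjoin_gen_eq_top] at h
    exact h trivial
  have hc1 : Valued.v (t 0) ≤ (1 : ℝ≥0) := by
    rw [← hw]
    exact ht.lt_one.le
  have ht0 : t 0 ≠ 0 := by
    have := ht.valuation_pos 0
    rintro h
    simp [h] at this
  have hple : Valued.v (p : K) ≤ (Valued.v (t 0) : ℝ≥0) := by
    rw [← hwp, ← hw]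
    exact (ht.valuation_natCast_lt 0).le
  let c : OK K := ⟨t 0, hc1⟩
  have hcp : c ∣ (p : OK K) := by
    refine ⟨⟨p / t 0, ?_⟩, Subtype.ext ?_⟩
    · change Valued.v (p / t 0) ≤ (1 : ℝ≥0)
      rw [map_div₀]
      exact div_le_one_of_le₀ hple zero_le
    · change (p : K) = t 0 * (p / t 0)
      field_simp
  have hsmul (a : OK K) (x : OK L) : ((a • x : OK L) : L) = algebraMap K L a * x := by
    rw [Algebra.smul_def, ← halg]
    rfl
  have hL0 : algebraMap K L (t 0) ≠ 0 := (_root_.map_ne_zero _).2 ht0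
  have happrox (x : OK L) : ∃ y z : OK L, x = y ^ p + c • z := by
    obtain ⟨_, ⟨y, rfl⟩, hy1, hxy⟩ := hE.exists_approx_root hinv ht hLE
      (φ.mem_fieldRange.2 ⟨x, rfl⟩) (hwv x.2)
    refine ⟨⟨y, hvw hy1⟩, ⟨(x - y ^ p) / algebraMap K L (t 0), hvw ?_⟩, Subtype.ext ?_⟩
    · rw [map_div₀, map_div₀, AlgHom.commutes, map_sub, map_pow]
      exact div_le_one_of_le₀ hxy zero_le
    · change (x : L) = y ^ p + ((c • _ : OK L) : L)
      rw [hsmul, mul_div_cancel₀ _ hL0]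
      ring
  set G := minpoly K pb.gen
  have hG' : aeval pb.gen (derivative G) ≠ 0 :=
    (Algebra.IsSeparable.isSeparable K pb.gen).aeval_derivative_ne_zero (minpoly.aeval _ _)
  obtain ⟨N, hN⟩ := exists_pow_lt_of_lt_one
    (w.pos_iff.2 ((_root_.map_ne_zero φ).2 hG')) ht.lt_one
  have hN' : w (algebraMap K _ (t 0 ^ N)) ≤ w (φ (aeval pb.gen (derivative G))) := by
    rw [map_pow, map_pow]
    exact hN.le
  let α : OK L := ⟨pb.gen, hpb⟩
  obtain ⟨g, hg⟩ := exists_polynomial_integer (G := minpoly K pb.gen) fun i => by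
    rw [← hw, ← minpoly.algHom_eq φ φ.injective pb.gen]
    exact valuation_coeff_minpoly_le_one hinv (hwv hpb) i
  have hgα : aeval α g = 0 := Subtype.ext <| by
    rw [coe_aeval_integer halg, hg]
    exact minpoly.aeval K pb.gen
  let u : OK L := ⟨algebraMap K L (t 0 ^ N) / aeval pb.gen (derivative G), hvw <| by
    rw [map_div₀, map_div₀, AlgHom.commutes]
    exact div_le_one_of_le₀ hN' zero_le⟩
  have hu : algebraMap (OK K) (OK L) (c ^ N) = u * aeval α (derivative g) := Subtype.ext <| by
    rw [halg, Subring.coe_mul, coe_aeval_integer halg, ← derivative_map, hg]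
    exact (div_mul_cancel₀ _ hG').symm
  refine kaehlerDifferential_subsingleton_of_pow_smul_eq_zero p hcp happrox (N := N + N)
    fun x => ?_
  obtain ⟨h, hh, hx⟩ := exists_smul_eq_sum_pow hinv φ pb (hwv hpb) hN' (hwv x.2)
  let q : (OK K)[X] :=
    ∑ i : Fin pb.dim, C ⟨h i, (hw _).symm.trans_le (hh i)⟩ * X ^ (i : ℕ)
  rw [pow_add]
  refine smul_smul_derivation_eq_zero hgα hu (q := q) (Subtype.ext ?_)
  rw [hsmul, coe_aeval_integer halg]
  simp only [q, Polynomial.map_sum, map_sum, Polynomial.map_mul, map_C, Polynomial.map_pow, map_X,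
    map_mul, aeval_C, map_pow, aeval_X]
  exact hx
end

section
/- Let K be a perfectoid analytic field and L a finite extension of K. Then the trace map Trace: m_L → m_K is surjective, where m_K, m_L are the maximal ideals of the valuation rings. -/
open scoped NNReal

set_option synthInstance.maxHeartbeats 1000000
set_option maxHeartbeats 1000000

/-- The norm of `K` takes values arbitrarily close to any positive real number. -/
def HasDenseNorm (K : Type*) [NormedField K] : Prop :=
  ∀ δ < (1 : ℝ), ∀ r > (0 : ℝ), ∃ c : K, δ < ‖c‖ * r ∧ ‖c‖ * r ≤ 1

/-- Every element of `K` is a `p`-th power up to a relative error `q`. -/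
def IsApproxPerfect (p : ℕ) (q : ℝ) (K : Type*) [NormedField K] : Prop :=
  ∀ c : K, ∃ b : K, ‖c - b ^ p‖ ≤ q * ‖c‖

theorem exists_pos_lt_one_lt_pow {q : ℝ} (hq : q < 1) (n : ℕ) :
    ∃ C : ℝ, 0 < C ∧ C < 1 ∧ q < C ^ n := by
  have h : Filter.Tendsto (fun C : ℝ => C ^ n) (nhdsWithin 1 (Set.Iio 1)) (nhds 1) := by
    have : ContinuousAt (fun C : ℝ => C ^ n) 1 := by fun_prop
    simpa using this.tendsto.mono_left nhdsWithin_le_nhds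
  have h1 := h.eventually (lt_mem_nhds hq)
  have h2 : ∀ᶠ C : ℝ in nhdsWithin 1 (Set.Iio 1), 0 < C :=
    nhdsWithin_le_nhds (lt_mem_nhds one_pos)
  obtain ⟨C, h3, h4, h5⟩ := (h1.and (h2.and self_mem_nhdsWithin)).exists
  exact ⟨C, h4, h5, h3⟩

section Ultrametric

theorem norm_sub_le_max_norm {V : Type*} [SeminormedAddCommGroup V] [IsUltrametricDist V]
    (x y : V) : ‖x - y‖ ≤ max ‖x‖ ‖y‖ := by
  simpa [sub_eq_add_neg] using IsUltrametricDist.norm_add_le_max x (-y)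

variable {E : Type*} [NormedField E] [IsUltrametricDist E]

theorem norm_add_pow_prime_sub_le {p : ℕ} (hp : p.Prime) {x y : E} {M : ℝ}
    (hx : ‖x‖ ≤ M) (hy : ‖y‖ ≤ M) :
    ‖(x + y) ^ p - (x ^ p + y ^ p)‖ ≤ ‖(p : E)‖ * M ^ p := by
  have hM : 0 ≤ M := (norm_nonneg x).trans hx
  rw [add_pow_prime_eq' hp, add_sub_cancel_left, norm_mul]
  refine mul_le_mul_of_nonneg_left ?_ (norm_nonneg _)
  refine IsUltrametricDist.norm_sum_le_of_forall_le_of_nonneg (pow_nonneg hM p) fun k hk => ?_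
  rw [norm_mul, norm_mul, norm_pow, norm_pow]
  have hkp : k ≤ p := (Finset.mem_Ioo.1 hk).2.le
  calc ‖x‖ ^ k * ‖y‖ ^ (p - k) * ‖((p.choose k / p : ℕ) : E)‖
      ≤ M ^ k * M ^ (p - k) * 1 := by
        gcongr
        exact IsUltrametricDist.norm_natCast_le_one E _
    _ = M ^ p := by rw [mul_one, ← pow_add, Nat.add_sub_cancel' hkp]

theorem norm_sum_pow_prime_sub_le {p : ℕ} (hp : p.Prime) {ι : Type*} (s : Finset ι) (f : ι → E)
    {M : ℝ} (hM : 0 ≤ M) (hf : ∀ i ∈ s, ‖f i‖ ≤ M) :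
    ‖(∑ i ∈ s, f i) ^ p - ∑ i ∈ s, f i ^ p‖ ≤ ‖(p : E)‖ * M ^ p := by
  classical
  induction s using Finset.induction_on with
  | empty => simp [hp.ne_zero]; positivity
  | insert a s ha ih =>
    rw [Finset.sum_insert ha, Finset.sum_insert ha]
    have h1 : ‖f a‖ ≤ M := hf a (Finset.mem_insert_self a s)
    have h2 : ‖∑ i ∈ s, f i‖ ≤ M := IsUltrametricDist.norm_sum_le_of_forall_le_of_nonneg hM
      fun i hi => hf i (Finset.mem_insert_of_mem hi)
    have h3 := ih fun i hi => hf i (Finset.mem_insert_of_mem hi)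
    have h4 := norm_add_pow_prime_sub_le hp h1 h2
    have : (f a + ∑ i ∈ s, f i) ^ p - (f a ^ p + ∑ i ∈ s, f i ^ p) =
        ((f a + ∑ i ∈ s, f i) ^ p - (f a ^ p + (∑ i ∈ s, f i) ^ p)) +
          ((∑ i ∈ s, f i) ^ p - ∑ i ∈ s, f i ^ p) := by ring
    rw [this]
    exact (IsUltrametricDist.norm_add_le_max _ _).trans (max_le h4 h3)

theorem norm_prod_sub_prod_le {ι : Type*} (s : Finset ι) (f g : ι → E) {θ : ℝ} (hθ : 0 ≤ θ)
    (hf : ∀ i ∈ s, ‖f i‖ ≤ 1) (hg : ∀ i ∈ s, ‖g i‖ ≤ 1) (hfg : ∀ i ∈ s, ‖f i - g i‖ ≤ θ) :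
    ‖∏ i ∈ s, f i - ∏ i ∈ s, g i‖ ≤ θ := by
  classical
  induction s using Finset.induction_on with
  | empty => simpa
  | insert a s ha ih =>
    rw [Finset.prod_insert ha, Finset.prod_insert ha]
    have h1 := ih (fun i hi => hf i (Finset.mem_insert_of_mem hi))
      (fun i hi => hg i (Finset.mem_insert_of_mem hi))
      (fun i hi => hfg i (Finset.mem_insert_of_mem hi))
    have h2 : ‖∏ i ∈ s, g i‖ ≤ 1 := by
      rw [norm_prod]
      exact Finset.prod_le_one (fun _ _ => norm_nonneg _)
        fun i hi => hg i (Finset.mem_insert_of_mem hi)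
    have h3 := hf a (Finset.mem_insert_self a s)
    have h4 := hfg a (Finset.mem_insert_self a s)
    have : f a * ∏ i ∈ s, f i - g a * ∏ i ∈ s, g i =
        f a * (∏ i ∈ s, f i - ∏ i ∈ s, g i) + (f a - g a) * ∏ i ∈ s, g i := by ring
    rw [this]
    refine (IsUltrametricDist.norm_add_le_max _ _).trans (max_le ?_ ?_)
    · rw [norm_mul]
      exact (mul_le_of_le_one_left (norm_nonneg _) h3).trans h1
    · rw [norm_mul]
      exact (mul_le_of_le_one_right (norm_nonneg _) h2).trans h4

theorem norm_natCast_eq_one_of_coprime {p n : ℕ} (hp : ‖(p : E)‖ < 1) (h : p.Coprime n) :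
    ‖(n : E)‖ = 1 := by
  refine le_antisymm (IsUltrametricDist.norm_natCast_le_one E n) ?_
  by_contra! hn
  have h1 : (p : E) * (p.gcdA n : ℤ) + (n : E) * (p.gcdB n : ℤ) = 1 := by
    have := Nat.gcd_eq_gcd_ab p n
    rw [h] at this
    exact_mod_cast congrArg (Int.cast : ℤ → E) this.symm
  have h2 : ‖(p : E) * (p.gcdA n : ℤ) + (n : E) * (p.gcdB n : ℤ)‖ < 1 := by
    refine (IsUltrametricDist.norm_add_le_max _ _).trans_lt (max_lt ?_ ?_)
    · rw [norm_mul]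
      exact (mul_le_of_le_one_right (norm_nonneg _)
        (IsUltrametricDist.norm_intCast_le_one E _)).trans_lt hp
    · rw [norm_mul]
      exact (mul_le_of_le_one_right (norm_nonneg _)
        (IsUltrametricDist.norm_intCast_le_one E _)).trans_lt hn
  rw [h1, norm_one] at h2
  exact lt_irrefl _ h2

end Ultrametric

section FiniteExtension

variable {K : Type*} [NontriviallyNormedField K] [CompleteSpace K]

/-- A finite-dimensional ultrametric normed space over a complete field has almost orthogonal
families of every length up to its dimension. -/
theorem exists_almost_orthogonal {V : Type*} [NormedAddCommGroup V] [NormedSpace K V]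
    [IsUltrametricDist V] [FiniteDimensional K V] (n : ℕ) (hn : n ≤ Module.finrank K V) :
    ∀ C : ℝ, 0 < C → C < 1 → ∃ e : Fin n → V, (∀ i, e i ≠ 0) ∧
      ∀ (c : Fin n → K) (i : Fin n), C * ‖c i • e i‖ ≤ ‖∑ j, c j • e j‖ := by
  induction n with
  | zero => exact fun C _ _ => ⟨Fin.elim0, fun i => i.elim0, fun _ i => i.elim0⟩
  | succ n ih =>
    intro C hC0 hC1
    set D := √C with hD
    have hD0 : 0 < D := Real.sqrt_pos.2 hC0
    have hDD : D * D = C := Real.mul_self_sqrt hC0.le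
    have hD1 : D < 1 := by nlinarith
    obtain ⟨e, he0, he⟩ := ih (by omega) D hD0 hD1
    set W : Submodule K V := Submodule.span K (Set.range e) with hW
    have hWtop : W ≠ ⊤ := by
      intro h
      have h1 : Module.finrank K W ≤ n := by
        simpa using! finrank_range_le_card (R := K) e
      rw [h, finrank_top] at h1
      omega
    obtain ⟨v, -, hv⟩ := SetLike.exists_of_lt (lt_top_iff_ne_top.2 hWtop)
    have hWc : IsClosed (W : Set V) := W.closed_of_finiteDimensional
    have hWne : (W : Set V).Nonempty := ⟨0, W.zero_mem⟩
    have hd : 0 < Metric.infDist v W := (hWc.notMem_iff_infDist_pos hWne).1 hv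
    obtain ⟨w, hw, hvw⟩ := (Metric.infDist_lt_iff hWne).1
      (show Metric.infDist v W < Metric.infDist v W / D from (lt_div_iff₀ hD0).2 (by nlinarith))
    rw [lt_div_iff₀ hD0, dist_eq_norm] at hvw
    have hlast : ∀ x ∈ W, ∀ c : K, D * ‖c • (v - w)‖ ≤ ‖x + c • (v - w)‖ := by
      intro x hx c
      rcases eq_or_ne c 0 with rfl | hc
      · simp
      have h1 : x + c • (v - w) = c • (v - (w - c⁻¹ • x)) := by
        simp only [smul_sub, smul_inv_smul₀ hc]; abel
      have h2 : Metric.infDist v W ≤ ‖v - (w - c⁻¹ • x)‖ := by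
        rw [← dist_eq_norm]
        exact Metric.infDist_le_dist_of_mem (W.sub_mem hw (W.smul_mem _ hx))
      rw [h1, norm_smul, norm_smul]
      have := norm_nonneg c
      nlinarith
    refine ⟨Fin.snoc (α := fun _ => V) e (v - w), fun i => ?_, fun c i => ?_⟩
    · refine Fin.lastCases ?_ (fun i => ?_) i
      · rw [Fin.snoc_last, sub_ne_zero]
        rintro rfl
        exact hv hw
      · rw [Fin.snoc_castSucc]
        exact he0 i
    · rw [Fin.sum_univ_castSucc]
      simp only [Fin.snoc_castSucc, Fin.snoc_last]
      set x := ∑ j : Fin n, c j.castSucc • e j with hx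
      have hxW : x ∈ W := W.sum_mem fun j _ => W.smul_mem _ (Submodule.subset_span ⟨j, rfl⟩)
      have h1 := hlast x hxW (c (Fin.last n))
      set z := c (Fin.last n) • (v - w)
      refine Fin.lastCases ?_ (fun i => ?_) i
      · rw [Fin.snoc_last]
        refine le_trans (mul_le_mul_of_nonneg_right ?_ (norm_nonneg z)) h1
        nlinarith
      · rw [Fin.snoc_castSucc]
        have h2 := he (fun j => c j.castSucc) i
        have h3 : ‖x‖ ≤ max ‖x + z‖ ‖z‖ := by
          simpa using norm_sub_le_max_norm (x + z) z
        have h4 : D * ‖x‖ ≤ ‖x + z‖ := by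
          rcases le_max_iff.1 h3 with h | h
          · nlinarith [norm_nonneg x]
          · nlinarith
        rw [← hDD]
        nlinarith

/-- Finite extensions of approximately perfect fields are approximately perfect. -/
theorem IsApproxPerfect.of_finite [IsUltrametricDist K] {p : ℕ} (hp : p.Prime) {q : ℝ} (hq1 : q < 1)
    (hpq : ‖(p : K)‖ ≤ q) (hK : IsApproxPerfect p q K)
    (E : Type*) [NormedField E] [NormedAlgebra K E] [IsUltrametricDist E]
    [FiniteDimensional K E] : ∃ q' < 1, IsApproxPerfect p q' E := by
  have hq0 : 0 ≤ q := (norm_nonneg _).trans hpq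
  obtain ⟨C, hC0, hC1, hqC⟩ := exists_pos_lt_one_lt_pow hq1 p
  obtain ⟨e, he0, he⟩ := exists_almost_orthogonal (K := K) (V := E) _ le_rfl C hC0 hC1
  have hpE : ‖(p : E)‖ ≤ q := by
    rw [← map_natCast (algebraMap K E), norm_algebraMap']
    exact hpq
  have key : ∀ c : Fin (Module.finrank K E) → K, ∃ y : E, ∀ i,
      C ^ p * ‖c i • e i ^ p‖ ≤ ‖∑ j, c j • e j ^ p‖ ∧
      ‖∑ j, c j • e j ^ p - y ^ p‖ ≤ q / C ^ p * ‖∑ j, c j • e j ^ p‖ := by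
    intro c
    choose b hb using fun i => hK (c i)
    have hbc : ∀ i, ‖b i‖ ^ p = ‖c i‖ := by
      intro i
      rcases eq_or_ne (c i) 0 with h | h
      · have := hb i
        rw [h] at this
        simp only [h, norm_zero, mul_zero, zero_sub, norm_neg, norm_pow] at this ⊢
        exact le_antisymm this (by positivity)
      · have h1 : ‖c i - b i ^ p‖ < ‖c i‖ :=
          (hb i).trans_lt (by nlinarith [norm_pos_iff.2 h])
        have h2 := IsUltrametricDist.norm_eq_of_add_norm_lt_max (x := c i) (y := -b i ^ p)
          (by rw [← sub_eq_add_neg]; exact h1.trans_le (le_max_left _ _))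
        rw [h2, norm_neg, norm_pow]
    refine ⟨∑ i, b i • e i, fun i => ?_⟩
    set x := ∑ j, c j • e j ^ p with hx
    set y := ∑ i, b i • e i with hy
    obtain ⟨m, -, hm⟩ := Finset.exists_max_image Finset.univ (fun j => ‖b j • e j‖)
      ⟨i, Finset.mem_univ i⟩
    set M := ‖b m • e m‖ with hM
    have hM0 : 0 ≤ M := norm_nonneg _
    have hbe : ∀ j, ‖c j • e j ^ p‖ = ‖b j • e j‖ ^ p := fun j => by
      rw [norm_smul, norm_smul, norm_pow, mul_pow, hbc]
    have h1 : ‖x - y ^ p‖ ≤ q * M ^ p := by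
      have h2 : ‖y ^ p - ∑ j, (b j • e j) ^ p‖ ≤ q * M ^ p :=
        (norm_sum_pow_prime_sub_le hp _ _ hM0 hm).trans (by gcongr)
      have h3 : ‖∑ j, (c j • e j ^ p - (b j • e j) ^ p)‖ ≤ q * M ^ p := by
        refine IsUltrametricDist.norm_sum_le_of_forall_le_of_nonneg (by positivity) fun j hj => ?_
        rw [smul_pow, ← sub_smul, norm_smul]
        calc _ ≤ q * ‖c j‖ * ‖e j ^ p‖ := by gcongr; exact hb j
          _ = q * ‖b j • e j‖ ^ p := by rw [← hbe, norm_smul, mul_assoc]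
          _ ≤ _ := by gcongr; exact hm j hj
      have h4 : x - y ^ p = ∑ j, (c j • e j ^ p - (b j • e j) ^ p) -
          (y ^ p - ∑ j, (b j • e j) ^ p) := by
        rw [Finset.sum_sub_distrib]; ring
      rw [h4]
      exact (norm_sub_le_max_norm _ _).trans (max_le h3 h2)
    have h5 : C ^ p * M ^ p ≤ ‖y ^ p‖ := by
      rw [← mul_pow, norm_pow]
      exact pow_le_pow_left₀ (by positivity) (he b m) p
    have h6 : C ^ p * M ^ p ≤ ‖x‖ := by
      have h7 : ‖y ^ p‖ ≤ max ‖x‖ ‖x - y ^ p‖ := by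
        simpa using norm_sub_le_max_norm x (x - y ^ p)
      rcases le_max_iff.1 h7 with h | h
      · exact h5.trans h
      · rcases hM0.eq_or_lt with h0 | h0
        · rw [← h0]; simp [hp.ne_zero]
        · have := pow_pos h0 p
          nlinarith
    refine ⟨le_trans ?_ h6, ?_⟩
    · rw [hbe]
      gcongr
      exact hm i (Finset.mem_univ i)
    · calc _ ≤ q * M ^ p := h1
        _ = q / C ^ p * (C ^ p * M ^ p) := by field_simp
        _ ≤ _ := by gcongr
  have hli : LinearIndependent K fun i => e i ^ p := by
    rw [Fintype.linearIndependent_iff]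
    intro c hc i
    obtain ⟨y, hy⟩ := key c
    have h1 := (hy i).1
    rw [hc, norm_zero] at h1
    have h2 : ‖c i • e i ^ p‖ ≤ 0 := by
      by_contra! h
      have := mul_pos (pow_pos hC0 p) h
      linarith
    rcases smul_eq_zero.1 (norm_le_zero_iff.1 h2) with h | h
    · exact h
    · exact absurd h (pow_ne_zero _ (he0 i))
  have hspan := hli.span_eq_top_of_card_eq_finrank' (by simp)
  refine ⟨q / C ^ p, (div_lt_one (by positivity)).2 hqC, fun x => ?_⟩
  obtain ⟨c, rfl⟩ := (Submodule.mem_span_range_iff_exists_fun K).1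
    (hspan ▸ Submodule.mem_top : x ∈ Submodule.span K (Set.range fun i => e i ^ p))
  obtain ⟨y, hy⟩ := key c
  exact ⟨y, (hy ⟨0, Module.finrank_pos⟩).2⟩

end FiniteExtension

section Galois

variable {K M : Type*} [NontriviallyNormedField K] [NormedField M] [NormedAlgebra K M]
  [IsUltrametricDist M]

theorem norm_pow_apply_sub_le {σ : Gal(M/K)} (hσ : ∀ x, ‖σ x‖ = ‖x‖) (x : M) (n : ℕ) :
    ‖(σ ^ n) x - x‖ ≤ ‖σ x - x‖ := by
  induction n with
  | zero => simp
  | succ n ih =>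
    have : (σ ^ (n + 1)) x - x = σ ((σ ^ n) x - x) + (σ x - x) := by
      rw [pow_succ', AlgEquiv.mul_apply, map_sub]; ring
    rw [this]
    refine (IsUltrametricDist.norm_add_le_max _ _).trans (max_le ?_ le_rfl)
    rw [hσ]
    exact ih

omit [IsUltrametricDist M] in
theorem norm_pow_apply {σ : Gal(M/K)} (hσ : ∀ x, ‖σ x‖ = ‖x‖) (x : M) (n : ℕ) :
    ‖(σ ^ n) x‖ = ‖x‖ := by
  induction n with
  | zero => simp
  | succ n ih => rw [pow_succ', AlgEquiv.mul_apply, hσ, ih]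

/-- An isometric automorphism of prime order invertible in the valuation ring moves some
integral element by almost `1`. -/
theorem exists_norm_apply_sub_gt_of_norm_eq_one (hD : HasDenseNorm K) {σ : Gal(M/K)}
    (hσ : ∀ x, ‖σ x‖ = ‖x‖) {l : ℕ} (hl : orderOf σ = l) (hσ1 : σ ≠ 1)
    (hl1 : ‖(l : M)‖ = 1) {θ : ℝ} (hθ : θ < 1) : ∃ x : M, ‖x‖ ≤ 1 ∧ θ < ‖σ x - x‖ := by
  obtain ⟨y, hy⟩ : ∃ y, σ y ≠ y := by
    by_contra! h
    exact hσ1 (AlgEquiv.ext h)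
  obtain ⟨c, hc1, hc2⟩ := hD θ hθ ‖σ y - y‖ (norm_pos_iff.2 (sub_ne_zero.2 hy))
  set x := c • (σ y - y) with hx
  rw [← norm_smul, ← hx] at hc1 hc2
  have hsum : ∑ i ∈ Finset.range l, (σ ^ i) x = 0 := by
    have h1 : ∀ i, (σ ^ i) x = c • ((σ ^ (i + 1)) y - (σ ^ i) y) := fun i => by
      rw [hx, map_smul, map_sub, pow_succ, AlgEquiv.mul_apply]
    simp_rw [h1]
    rw [← Finset.smul_sum, Finset.sum_range_sub (fun i => (σ ^ i) y), ← hl, pow_orderOf_eq_one]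
    simp
  refine ⟨x, hc2, hc1.trans_le ?_⟩
  have h2 : (l : M) * x = ∑ i ∈ Finset.range l, (x - (σ ^ i) x) := by
    rw [Finset.sum_sub_distrib, hsum]; simp
  calc ‖x‖ = ‖(l : M) * x‖ := by rw [norm_mul, hl1, one_mul]
    _ ≤ _ := by
      rw [h2]
      refine IsUltrametricDist.norm_sum_le_of_forall_le_of_nonneg (norm_nonneg _) fun i _ => ?_
      rw [norm_sub_rev]
      exact norm_pow_apply_sub_le hσ x i

/-- An isometric automorphism of order `p` of a finite extension of an approximately perfect
field moves some integral element by almost `1`. -/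
theorem exists_norm_apply_sub_gt_of_orderOf_eq [CompleteSpace K] [IsUltrametricDist K]
    [FiniteDimensional K M] (hD : HasDenseNorm K) {p : ℕ} (hp : p.Prime) {q : ℝ} (hq1 : q < 1)
    (hpq : ‖(p : K)‖ ≤ q) (hK : IsApproxPerfect p q K) {σ : Gal(M/K)}
    (hσ : ∀ x, ‖σ x‖ = ‖x‖) (hl : orderOf σ = p) {θ : ℝ} (hθ : θ < 1) :
    ∃ x : M, ‖x‖ ≤ 1 ∧ θ < ‖σ x - x‖ := by
  set E : IntermediateField K M := IntermediateField.fixedField (Subgroup.zpowers σ) with hE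
  have hmem : ∀ x, x ∈ E ↔ σ x = x := fun x => by
    rw [hE, IntermediateField.mem_fixedField_iff]
    refine ⟨fun h => h σ (Subgroup.mem_zpowers σ), fun h f hf => ?_⟩
    exact (Subgroup.zpowers_le (H := MulAction.stabilizer Gal(M/K) x)).2 h hf
  have : IsUltrametricDist E := inferInstance
  obtain ⟨q', hq'1, hE'⟩ := hK.of_finite hp hq1 hpq E
  obtain ⟨α, hα⟩ : ∃ y, y ∉ E := by
    by_contra! h
    have : σ = 1 := AlgEquiv.ext fun x => (hmem x).1 (h x)
    rw [this, orderOf_one] at hl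
    exact hp.one_lt.ne hl
  have hpM : ‖(p : M)‖ ≤ q := by
    rw [← map_natCast (algebraMap K M), norm_algebraMap']
    exact hpq
  have hm : max (max q q') θ < 1 := max_lt (max_lt hq1 hq'1) hθ
  obtain ⟨δ, hδ0, hδ1, hδ⟩ := exists_pos_lt_one_lt_pow hm (2 * p)
  have hEne : (E : Set M).Nonempty := ⟨0, E.zero_mem⟩
  have hEc : IsClosed (E : Set M) :=
    (Subalgebra.toSubmodule E.toSubalgebra).closed_of_finiteDimensional
  have hd : 0 < Metric.infDist α E := (hEc.notMem_iff_infDist_pos hEne).1 hα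
  obtain ⟨a, ha, hαa⟩ := (Metric.infDist_lt_iff hEne).1
    (show Metric.infDist α E < Metric.infDist α E / δ from (lt_div_iff₀ hδ0).2 (by nlinarith))
  rw [lt_div_iff₀ hδ0, dist_eq_norm] at hαa
  have hαa0 : 0 < ‖α - a‖ := by
    rw [norm_pos_iff, sub_ne_zero]
    rintro rfl
    exact hα ha
  obtain ⟨c, hc1, hc2⟩ := hD δ hδ1 _ hαa0
  have hc0 : c ≠ 0 := by
    rintro rfl
    rw [norm_zero, zero_mul] at hc1
    exact hc1.not_gt hδ0
  set x := c • (α - a) with hx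
  have hx1 : ‖x‖ ≤ 1 := by rwa [hx, norm_smul]
  have hdist : ∀ b ∈ E, δ ^ 2 ≤ ‖x - b‖ := by
    intro b hb
    have h1 : x - b = c • (α - (a + c⁻¹ • b)) := by
      simp only [hx, smul_sub, smul_add, smul_inv_smul₀ hc0]; ring
    have h2 : Metric.infDist α E ≤ ‖α - (a + c⁻¹ • b)‖ := by
      rw [← dist_eq_norm]
      exact Metric.infDist_le_dist_of_mem (E.add_mem ha (E.smul_mem hb))
    rw [h1, norm_smul]
    have h3 : ‖α - a‖ * δ ≤ ‖α - (a + c⁻¹ • b)‖ := hαa.le.trans h2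
    calc δ ^ 2 = δ * δ := sq δ
      _ ≤ (‖c‖ * ‖α - a‖) * δ := by gcongr
      _ = ‖c‖ * (‖α - a‖ * δ) := mul_assoc _ _ _
      _ ≤ _ := by gcongr
  have hx0 : x ≠ 0 := by
    intro h
    have := hdist 0 E.zero_mem
    rw [h, sub_zero, norm_zero] at this
    have := pow_pos hδ0 2
    linarith
  set N := ∏ i ∈ Finset.range p, (σ ^ i) x with hN
  have hNE : N ∈ E := by
    rw [hmem, hN, map_prod]
    have h1 := (Finset.prod_range_succ (fun i => (σ ^ i) x) p).symm.trans
      (Finset.prod_range_succ' (fun i => (σ ^ i) x) p)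
    rw [show (σ ^ p) x = x by rw [← hl, pow_orderOf_eq_one]; rfl,
      show (σ ^ 0) x = x by rw [pow_zero]; rfl] at h1
    rw [mul_right_cancel₀ hx0 h1]
    simp_rw [pow_succ', AlgEquiv.mul_apply]
  have hN1 : ‖N‖ ≤ 1 := by
    rw [hN, norm_prod]
    exact Finset.prod_le_one (fun _ _ => norm_nonneg _) fun i _ => by rwa [norm_pow_apply hσ]
  have hNx : ‖N - x ^ p‖ ≤ ‖σ x - x‖ := by
    have := norm_prod_sub_prod_le (Finset.range p) (fun i => (σ ^ i) x) (fun _ => x)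
      (norm_nonneg (σ x - x)) (fun i _ => by rwa [norm_pow_apply hσ]) (fun _ _ => hx1)
      (fun i _ => norm_pow_apply_sub_le hσ x i)
    simpa only [Finset.prod_const, Finset.card_range] using this
  obtain ⟨b, hb⟩ := hE' ⟨N, hNE⟩
  have hb' : ‖N - (b : M) ^ p‖ ≤ q' * ‖N‖ := hb
  refine ⟨x, hx1, ?_⟩
  by_contra! hcon
  have hm0 : 0 ≤ max q q' := ((norm_nonneg _).trans hpq).trans (le_max_left _ _)
  have hNb : ‖N - (b : M) ^ p‖ ≤ max q q' := hb'.trans <|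
    (mul_le_mul_of_nonneg_right (le_max_right q q') (norm_nonneg N)).trans
      (mul_le_of_le_one_right hm0 hN1)
  have hb1 : ‖(b : M)‖ ≤ 1 := by
    have h1 : ‖(b : M) ^ p‖ ≤ 1 := by
      have := norm_sub_le_max_norm N (N - (b : M) ^ p)
      rw [sub_sub_cancel] at this
      exact this.trans (max_le hN1 (hNb.trans (max_lt hq1 hq'1).le))
    rw [norm_pow] at h1
    exact (pow_le_one_iff_of_nonneg (norm_nonneg _) hp.ne_zero).1 h1
  have hxb : ‖x - b‖ ≤ 1 := (norm_sub_le_max_norm _ _).trans (max_le hx1 hb1)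
  have h1 := norm_add_pow_prime_sub_le hp hxb hb1
  rw [sub_add_cancel, one_pow, mul_one] at h1
  have h2 : (x - b) ^ p = (N - (b : M) ^ p) - (N - x ^ p) -
      (x ^ p - ((x - b) ^ p + (b : M) ^ p)) := by ring
  have h3 : ‖(x - b) ^ p‖ ≤ max (max q q') θ := by
    rw [h2]
    refine (norm_sub_le_max_norm _ _).trans (max_le ((norm_sub_le_max_norm _ _).trans ?_) ?_)
    · exact max_le_max hNb (hNx.trans hcon)
    · exact h1.trans (hpM.trans ((le_max_left _ _).trans (le_max_left _ _)))
  have h4 : (δ ^ 2) ^ p ≤ ‖(x - b) ^ p‖ := by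
    rw [norm_pow]
    exact pow_le_pow_left₀ (by positivity) (hdist b b.2) p
  rw [← pow_mul] at h4
  linarith

variable [CompleteSpace K] [IsUltrametricDist K] [FiniteDimensional K M]

/-- A nontrivial isometric automorphism of a finite extension of an approximately perfect
field moves some integral element by almost `1`. -/
theorem exists_norm_apply_sub_gt (hD : HasDenseNorm K) {p : ℕ} (hp : p.Prime) {q : ℝ}
    (hq1 : q < 1) (hpq : ‖(p : K)‖ ≤ q) (hK : IsApproxPerfect p q K) {σ : Gal(M/K)}
    (hσ : ∀ x, ‖σ x‖ = ‖x‖) (hσ1 : σ ≠ 1) {θ : ℝ} (hθ : θ < 1) :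
    ∃ x : M, ‖x‖ ≤ 1 ∧ θ < ‖σ x - x‖ := by
  have ho : orderOf σ ≠ 1 := fun h => hσ1 (orderOf_eq_one_iff.1 h)
  have ho0 : orderOf σ ≠ 0 := (orderOf_pos σ).ne'
  obtain ⟨l, hl, k, hk⟩ := Nat.exists_prime_and_dvd ho
  have hk0 : k ≠ 0 := by
    rintro rfl
    exact ho0 hk
  have hτl : orderOf (σ ^ k) = l := by
    rw [orderOf_pow' σ hk0, hk, Nat.gcd_mul_left_left, Nat.mul_div_cancel _ (Nat.pos_of_ne_zero hk0)]
  have hτ : ∀ x, ‖(σ ^ k) x‖ = ‖x‖ := fun x => norm_pow_apply hσ x k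
  have key : ∃ x : M, ‖x‖ ≤ 1 ∧ θ < ‖(σ ^ k) x - x‖ := by
    rcases eq_or_ne p l with rfl | hpl
    · exact exists_norm_apply_sub_gt_of_orderOf_eq hD hp hq1 hpq hK hτ hτl hθ
    · refine exists_norm_apply_sub_gt_of_norm_eq_one hD hτ hτl ?_ ?_ hθ
      · intro h
        rw [h, orderOf_one] at hτl
        exact hl.one_lt.ne hτl
      · refine norm_natCast_eq_one_of_coprime (p := p) ?_ ((Nat.coprime_primes hp hl).2 hpl)
        rw [← map_natCast (algebraMap K M), norm_algebraMap']
        exact hpq.trans_lt hq1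
  obtain ⟨x, hx1, hx2⟩ := key
  exact ⟨x, hx1, hx2.trans_le (norm_pow_apply_sub_le hσ x k)⟩

/-- The trace of a finite Galois extension of an approximately perfect field takes values of
norm almost `1` on integral elements. -/
theorem exists_norm_sum_gal_gt (hD : HasDenseNorm K) {p : ℕ} (hp : p.Prime) {q : ℝ}
    (hq1 : q < 1) (hpq : ‖(p : K)‖ ≤ q) (hK : IsApproxPerfect p q K)
    (hσ : ∀ (σ : Gal(M/K)) (x : M), ‖σ x‖ = ‖x‖) {θ : ℝ} (hθ : θ < 1) :
    ∃ x : M, ‖x‖ ≤ 1 ∧ θ < ‖∑ σ : Gal(M/K), σ x‖ := by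
  classical
  set S : Finset Gal(M/K) := Finset.univ.erase 1 with hS
  obtain ⟨C, hC0, hC1, hC⟩ := exists_pos_lt_one_lt_pow hθ S.card
  have hex : ∀ σ : Gal(M/K), ∃ x : M, ‖x‖ ≤ 1 ∧ (σ ≠ 1 → C < ‖σ x - x‖) := fun σ => by
    by_cases h : σ = 1
    · exact ⟨0, by simp, fun h' => absurd h h'⟩
    · obtain ⟨x, h1, h2⟩ := exists_norm_apply_sub_gt hD hp hq1 hpq hK (hσ σ) h hC1
      exact ⟨x, h1, fun _ => h2⟩
  choose x hx1 hx using hex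
  have hprod : ∀ τ : Gal(M/K), ∏ σ ∈ S, (σ (x σ) - τ (x σ)) =
      ∑ t ∈ S.powerset, (∏ σ ∈ t, σ (x σ)) * τ (∏ σ ∈ S \ t, -x σ) := fun τ => by
    simp_rw [sub_eq_add_neg, Finset.prod_add, map_prod, map_neg]
  have hsum : ∏ σ ∈ S, (σ (x σ) - x σ) =
      ∑ t ∈ S.powerset, (∏ σ ∈ t, σ (x σ)) * ∑ τ : Gal(M/K), τ (∏ σ ∈ S \ t, -x σ) := by
    simp_rw [Finset.mul_sum]
    rw [Finset.sum_comm]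
    simp_rw [← hprod]
    rw [Finset.sum_eq_single 1]
    · rfl
    · exact fun τ _ hτ => Finset.prod_eq_zero
        (Finset.mem_erase.2 ⟨hτ, Finset.mem_univ τ⟩) (sub_self _)
    · exact fun h => absurd (Finset.mem_univ _) h
  by_contra! hcon
  have hθ0 : 0 ≤ θ := by simpa using hcon 0 (by simp)
  have hle : ‖∏ σ ∈ S, (σ (x σ) - x σ)‖ ≤ θ := by
    rw [hsum]
    refine IsUltrametricDist.norm_sum_le_of_forall_le_of_nonneg hθ0 fun t _ => ?_
    rw [norm_mul]
    have h1 : ‖∏ σ ∈ t, σ (x σ)‖ ≤ 1 := by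
      rw [norm_prod]
      exact Finset.prod_le_one (fun _ _ => norm_nonneg _) fun σ _ => by rw [hσ]; exact hx1 σ
    refine (mul_le_of_le_one_left (norm_nonneg _) h1).trans (hcon _ ?_)
    rw [norm_prod]
    exact Finset.prod_le_one (fun _ _ => norm_nonneg _) fun σ _ => by rw [norm_neg]; exact hx1 σ
  have hge : C ^ S.card ≤ ‖∏ σ ∈ S, (σ (x σ) - x σ)‖ := by
    rw [norm_prod, ← Finset.prod_const]
    exact Finset.prod_le_prod (fun _ _ => hC0.le)
      fun σ hs => (hx σ (Finset.mem_erase.1 hs).1).le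
  linarith

end Galois

section Trace

variable {K : Type*} [NontriviallyNormedField K] [CompleteSpace K] [IsUltrametricDist K]

/-- The trace of a finite extension of an approximately perfect field of characteristic zero takes
values of norm almost `1` on integral elements. -/
theorem exists_norm_trace_gt (hD : HasDenseNorm K) {p : ℕ} (hp : p.Prime) {q : ℝ}
    (hq1 : q < 1) (hpq : ‖(p : K)‖ ≤ q) (hK : IsApproxPerfect p q K)
    (L : Type*) [Field L] [Algebra K L] [FiniteDimensional K L] [CharZero K]
    {θ : ℝ} (hθ : θ < 1) :
    ∃ x : L, spectralNorm K L x ≤ 1 ∧ θ < ‖Algebra.trace K L x‖ := by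
  have : Algebra.IsAlgebraic K (AlgebraicClosure L) := Algebra.IsAlgebraic.trans K L _
  let M := IntermediateField.normalClosure K L (AlgebraicClosure L)
  have : FiniteDimensional K M := normalClosure.is_finiteDimensional K L _
  have : FiniteDimensional L M := Module.Finite.of_restrictScalars_finite K L M
  have : IsAlgClosure K (AlgebraicClosure L) := ⟨inferInstance, inferInstance⟩
  have : Normal K (AlgebraicClosure L) := IsAlgClosure.normal K _
  have : IsGalois K M := ⟨⟩
  have : IsGalois L M := IsGalois.tower_top_of_isGalois K L M
  let _ : NormedField M := spectralNorm.normedField K M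
  let _ : NormedAlgebra K M := spectralNorm.normedAlgebra K M
  have hna : IsUltrametricDist M :=
    IsUltrametricDist.isUltrametricDist_of_isNonarchimedean_norm isNonarchimedean_spectralNorm
  have hσ : ∀ (σ : Gal(M/K)) (x : M), ‖σ x‖ = ‖x‖ := fun σ x =>
    (spectralNorm_eq_of_equiv σ x).symm
  obtain ⟨b, hb1, hb⟩ := exists_norm_sum_gal_gt hD hp hq1 hpq hK hσ hθ
  refine ⟨Algebra.trace L M b, ?_, ?_⟩
  · rw [spectralNorm.eq_of_tower (L := M), trace_eq_sum_automorphisms]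
    change ‖∑ σ : Gal(M/L), σ b‖ ≤ 1
    refine IsUltrametricDist.norm_sum_le_of_forall_le_of_nonneg zero_le_one fun σ _ => ?_
    exact (hσ (σ.restrictScalars K) b).trans_le hb1
  · rw [Algebra.trace_trace, ← norm_algebraMap' M, trace_eq_sum_automorphisms]
    exact hb

end Trace

section Valued

variable {K : Type*} [Field K] [Valued K ℝ≥0]

theorem exists_valuation_mul_mem_of_not_isDiscretelyValued (hK : ¬ IsDiscretelyValued K)
    (hnt : ∃ x : K, x ≠ 0 ∧ Valued.v x ≠ 1) {δ r : ℝ} (hδ : δ < 1) (hr : 0 < r) :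
    ∃ c : K, δ < ((Valued.v c : ℝ≥0) : ℝ) * r ∧ ((Valued.v c : ℝ≥0) : ℝ) * r ≤ 1 := by
  have hpos : ∀ x : K, x ≠ 0 → 0 < ((Valued.v x : ℝ≥0) : ℝ) := fun x hx =>
    NNReal.coe_pos.2 (zero_lt_iff.2 ((Valuation.ne_zero_iff _).2 hx))
  let S : AddSubgroup ℝ :=
    { carrier := {t | ∃ x : K, x ≠ 0 ∧ Real.log (Valued.v x : ℝ≥0) = t}
      zero_mem' := ⟨1, one_ne_zero, by simp⟩
      add_mem' := by
        rintro _ _ ⟨x, hx, rfl⟩ ⟨y, hy, rfl⟩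
        refine ⟨x * y, mul_ne_zero hx hy, ?_⟩
        rw [map_mul, NNReal.coe_mul, Real.log_mul (hpos x hx).ne' (hpos y hy).ne']
      neg_mem' := by
        rintro _ ⟨x, hx, rfl⟩
        exact ⟨x⁻¹, inv_ne_zero hx, by rw [map_inv₀, NNReal.coe_inv, Real.log_inv]⟩ }
  rcases S.dense_or_cyclic with h | ⟨a, ha⟩
  · set ε := max δ (1 / 2) with hε
    have hε0 : 0 < ε := lt_max_of_lt_right (by norm_num)
    have hε1 : ε < 1 := max_lt hδ (by norm_num)
    obtain ⟨_, ⟨x, hx, rfl⟩, h1, h2⟩ := h.exists_between (show Real.log (ε / r) < Real.log (1 / r)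
      from Real.log_lt_log (by positivity) (by gcongr))
    rw [Real.log_lt_log_iff (by positivity) (hpos x hx), div_lt_iff₀ hr] at h1
    rw [Real.log_lt_log_iff (hpos x hx) (by positivity), lt_div_iff₀ hr] at h2
    exact ⟨x, (le_max_left _ _).trans_lt h1, h2.le⟩
  · exfalso
    have hmul : ∀ x : K, x ≠ 0 → ∃ n : ℤ, n * a = Real.log (Valued.v x : ℝ≥0) := fun x hx => by
      have : Real.log (Valued.v x : ℝ≥0) ∈ S := ⟨x, hx, rfl⟩
      rw [ha, AddSubgroup.mem_closure_singleton] at this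
      simpa using this
    have ha0 : a ≠ 0 := by
      rintro rfl
      obtain ⟨x, hx, hx1⟩ := hnt
      obtain ⟨n, hn⟩ := hmul x hx
      rw [mul_zero] at hn
      have := Real.eq_one_of_pos_of_log_eq_zero (hpos x hx) hn.symm
      exact hx1 (by exact_mod_cast this)
    refine hK ⟨(Real.exp (-|a|)).toNNReal, ?_, fun x hx => ?_⟩
    · rw [Real.toNNReal_lt_one]
      exact Real.exp_lt_one_iff.2 (neg_lt_zero.2 (abs_pos.2 ha0))
    · obtain ⟨n, hn⟩ := hmul x hx
      have key : ∃ m : ℤ, (m : ℝ) * -|a| = n * a := by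
        rcases abs_choice a with h | h <;> rw [h]
        · exact ⟨-n, by push_cast; ring⟩
        · exact ⟨n, by ring⟩
      obtain ⟨m, hm⟩ := key
      refine ⟨m, NNReal.coe_injective ?_⟩
      rw [NNReal.coe_zpow, Real.coe_toNNReal _ (Real.exp_pos _).le, ← Real.rpow_intCast,
        ← Real.exp_mul, mul_comm, hm, hn, Real.exp_log (hpos x hx)]

theorem exists_valuation_sub_pow_le {p : ℕ} (hfrob : ∀ a : OKmodp p K, ∃ b, b ^ p = a) {x : K}
    (hx : Valued.v x ≤ 1) : ∃ b : K, Valued.v (x - b ^ p) ≤ Valued.v (p : K) := by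
  obtain ⟨b, hb⟩ := hfrob (Ideal.Quotient.mk _ ⟨x, hx⟩)
  obtain ⟨b, rfl⟩ := Ideal.Quotient.mk_surjective b
  rw [← map_pow, eq_comm, Ideal.Quotient.eq, Ideal.mem_span_singleton'] at hb
  obtain ⟨z, hz⟩ := hb
  have hz' := congrArg Subtype.val hz
  refine ⟨b, ?_⟩
  have h1 : x - (b : K) ^ p = z * (p : K) := by simpa using hz'.symm
  rw [h1, map_mul]
  exact mul_le_of_le_one_left' z.2

end Valued

theorem IsApproxPerfect.of_integral {K : Type*} [NormedField K] (hD : HasDenseNorm K) {p : ℕ}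
    (hp : p ≠ 0) {q : ℝ} (hpq : ‖(p : K)‖ < q)
    (h : ∀ x : K, ‖x‖ ≤ 1 → ∃ b : K, ‖x - b ^ p‖ ≤ ‖(p : K)‖) : IsApproxPerfect p q K := by
  intro c
  rcases eq_or_ne c 0 with rfl | hc
  · exact ⟨0, by simp [hp]⟩
  have hq0 : 0 < q := (norm_nonneg _).trans_lt hpq
  obtain ⟨δ, hδ0, hδ1, hδ⟩ := exists_pos_lt_one_lt_pow ((div_lt_one hq0).2 hpq) p
  have hc' := norm_pos_iff.2 hc
  obtain ⟨s, hs1, hs2⟩ := hD δ hδ1 (‖c‖ ^ (p⁻¹ : ℝ)) (by positivity)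
  have hs0 : s ≠ 0 := by
    rintro rfl
    rw [norm_zero, zero_mul] at hs1
    exact hs1.not_gt hδ0
  have hsp : (‖s‖ * ‖c‖ ^ (p⁻¹ : ℝ)) ^ p = ‖s ^ p * c‖ := by
    rw [mul_pow, Real.rpow_inv_natCast_pow hc'.le hp, norm_mul, norm_pow]
  have h1 : ‖s ^ p * c‖ ≤ 1 := hsp ▸ pow_le_one₀ (by positivity) hs2
  have h2 : ‖(p : K)‖ / q < ‖s ^ p * c‖ := hδ.trans (hsp ▸ pow_lt_pow_left₀ hs1 hδ0.le hp)
  obtain ⟨b, hb⟩ := h _ h1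
  refine ⟨b / s, ?_⟩
  have h3 : s ^ p * (c - (b / s) ^ p) = s ^ p * c - b ^ p := by
    rw [mul_sub, div_pow, mul_div_cancel₀ _ (pow_ne_zero p hs0)]
  have h4 : ‖s ^ p‖ * ‖c - (b / s) ^ p‖ ≤ ‖s ^ p‖ * (q * ‖c‖) := by
    rw [← norm_mul, h3, mul_left_comm, ← norm_mul]
    rw [div_lt_iff₀' hq0] at h2
    exact hb.trans h2.le
  exact le_of_mul_le_mul_left h4 (norm_pos_iff.2 (pow_ne_zero p hs0))

/-- Let `K` be a perfectoid analytic field and `L` a finite extension of `K`.  Then the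
trace map sends the maximal ideal `m_L` of `o_L` onto the maximal ideal `m_K` of `o_K`. -/
theorem perfectoid_trace_surjective (p : ℕ) [Fact p.Prime] (K : Type*) [Field K]
    [Valued K ℝ≥0] [CompleteSpace K]
    (hp : Valued.v (p : K) = (p : ℝ≥0)⁻¹)
    (hnd : ¬ IsDiscretelyValued K)
    (hfrob : ∀ a : OKmodp p K, ∃ b, b ^ p = a)
    (L : Type*) [Field L] [Algebra K L] [FiniteDimensional K L]
    [Valued L ℝ≥0]
    (hext : ∀ x : K, Valued.v (algebraMap K L x) = Valued.v x) :
    ∀ y : K, Valued.v y < 1 → ∃ x : L, Valued.v x < 1 ∧ Algebra.trace K L x = y := by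
  have hprime : p.Prime := Fact.out
  have hpinv : (p : ℝ≥0)⁻¹ < 1 := inv_lt_one_of_one_lt₀ (by exact_mod_cast hprime.one_lt)
  have hp0 : (p : K) ≠ 0 := by
    intro h
    rw [h, map_zero] at hp
    exact inv_ne_zero (by exact_mod_cast hprime.ne_zero) hp.symm
  let hrank : (Valued.v : Valuation K ℝ≥0).RankOne :=
    { hom' := MonoidWithZeroHom.ValueGroup₀.embedding
      strictMono' := MonoidWithZeroHom.ValueGroup₀.embedding_strictMono
      exists_val_nontrivial := ⟨p, by simpa using hp0, by rw [hp]; exact hpinv.ne⟩ }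
  let _ : NontriviallyNormedField K := Valued.toNontriviallyNormedField K ℝ≥0
  have hnorm : ∀ x : K, ‖x‖ = ((Valued.v x : ℝ≥0) : ℝ) := fun x =>
    congrArg NNReal.toReal (Valuation.embedding_restrict (Valued.v : Valuation K ℝ≥0) x)
  have hna : IsUltrametricDist K :=
    IsUltrametricDist.isUltrametricDist_of_isNonarchimedean_norm
      (Valued.isNonarchimedean_norm K ℝ≥0)
  have hD : HasDenseNorm K := fun δ hδ r hr => by
    simp_rw [hnorm]
    exact exists_valuation_mul_mem_of_not_isDiscretelyValued hnd
      ⟨p, hp0, by rw [hp]; exact hpinv.ne⟩ hδ hr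
  have hp1 : ‖(p : K)‖ < 1 := by
    rw [hnorm, hp]
    exact_mod_cast hpinv
  have hchar : CharZero K := charZero_of_inj_zero fun n hn => by
    by_contra hn0
    obtain ⟨k, m, hm, rfl⟩ := Nat.exists_eq_pow_mul_and_not_dvd hn0 p hprime.ne_one
    rw [Nat.cast_mul, Nat.cast_pow, mul_eq_zero, or_iff_right (pow_ne_zero k hp0)] at hn
    have := norm_natCast_eq_one_of_coprime hp1 ((Nat.Prime.coprime_iff_not_dvd hprime).2 hm)
    rw [hn, norm_zero] at this
    exact zero_ne_one this
  obtain ⟨q, hpq, hq1⟩ := exists_between hp1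
  have hK : IsApproxPerfect p q K := by
    refine IsApproxPerfect.of_integral hD hprime.ne_zero hpq fun x hx => ?_
    rw [hnorm] at hx
    obtain ⟨b, hb⟩ := exists_valuation_sub_pow_le hfrob (x := x) (by exact_mod_cast hx)
    exact ⟨b, by rw [hnorm, hnorm]; exact_mod_cast hb⟩
  intro y hy
  have hy' : ‖y‖ < 1 := by rw [hnorm]; exact_mod_cast hy
  obtain ⟨x, hx1, hx⟩ := exists_norm_trace_gt hD hprime hq1 hpq.le hK L hy'
  let f : AbsoluteValue L ℝ :=
    { toFun := fun z => ((Valued.v z : ℝ≥0) : ℝ)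
      map_mul' := fun a b => by rw [map_mul, NNReal.coe_mul]
      nonneg' := fun a => NNReal.coe_nonneg _
      eq_zero' := fun a => by simp
      add_le' := fun a b => by
        refine le_trans (NNReal.coe_le_coe.2 (Valuation.map_add _ a b)) ?_
        rw [← NNReal.coe_add, NNReal.coe_le_coe]
        exact max_le (le_add_of_nonneg_right zero_le) (le_add_of_nonneg_left zero_le) }
  have hf : ∀ z : L, ((Valued.v z : ℝ≥0) : ℝ) = spectralNorm K L z := fun z =>
    spectralNorm_unique_field_norm_ext (f := f)
      (fun c => by rw [hnorm]; exact congrArg NNReal.toReal (hext c)) z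
  have hxv : Valued.v x ≤ 1 := by
    rw [← hf] at hx1
    exact_mod_cast hx1
  set t := Algebra.trace K L x with ht
  have ht0 : t ≠ 0 := norm_pos_iff.1 ((norm_nonneg y).trans_lt hx)
  have hyt : Valued.v (y / t) < 1 := by
    have : ‖y / t‖ < 1 := by
      rw [norm_div]
      exact (div_lt_one (norm_pos_iff.2 ht0)).2 hx
    rw [hnorm] at this
    exact_mod_cast this
  refine ⟨(y / t) • x, ?_, ?_⟩
  · rw [Algebra.smul_def, map_mul, hext]
    exact (mul_le_of_le_one_right' hxv).trans_lt hyt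
  · rw [map_smul, ← ht, smul_eq_mul, div_mul_cancel₀ _ ht0]
end
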